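/- arXiv:2509.16802 — 2 statements merged into one kernel-verified Lean document; each statement's English description precedes it below -/
import Mathlib

section
/- Let k = p^ν be a power of a prime, let M be a finite set, and let v_1, …, v_n : 2^M → ℝ be valuation functions. Then there exists a fractional k-coloring χ : M → Δ_k such that (1) for every i ∈ [n] and all ℓ, ℓ' ∈ [k], F_i(χ_ℓ) = F_i(χ_{ℓ'}), where F_i is the multilinear extension of v_i, and (2) for each ℓ ∈ [k], the vector χ_ℓ has at most 2n non-integral coordinates. -/
/-- The multilinear extension of a set function `v : Finset α → ℝ`:
`F(x) = ∑_{S ⊆ M} v(S) ∏_{j ∈ S} x_j ∏_{j ∉ S} (1 - x_j)`. -/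
noncomputable def mlext {α : Type*} [Fintype α] [DecidableEq α]
    (v : Finset α → ℝ) (x : α → ℝ) : ℝ :=
  ∑ S : Finset α, v S * ((∏ j ∈ S, x j) * ∏ j ∈ Sᶜ, (1 - x j))

/-- Chains of finite lists: the augmented ordered chain complex on the vertex set `X`. -/
abbrev ListChain (K X : Type*) [Field K] := List X →₀ K

namespace ListChain

variable {K X Y : Type*} [Field K]

theorem map_mem_of_supported {M : Type*} [AddCommGroup M] [Module K M] {s : Set (List X)}
    {N : Submodule K M} (F : ListChain K X →ₗ[K] M)
    (h : ∀ l ∈ s, F (Finsupp.single l 1) ∈ N) {c : ListChain K X}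
    (hc : c ∈ Finsupp.supported K K s) : F c ∈ N := by
  rw [Finsupp.supported_eq_span_single] at hc
  have : Submodule.span K ((fun i => Finsupp.single i (1 : K)) '' s) ≤ N.comap F := by
    rw [Submodule.span_le]
    rintro _ ⟨l, hl, rfl⟩
    exact h l hl
  exact this hc

theorem eq_zero_of_supported {M : Type*} [AddCommGroup M] [Module K M] {s : Set (List X)}
    (F : ListChain K X →ₗ[K] M) (h : ∀ l ∈ s, F (Finsupp.single l 1) = 0) {c : ListChain K X}
    (hc : c ∈ Finsupp.supported K K s) : F c = 0 := by
  have := map_mem_of_supported (N := ⊥) F (fun l hl => by simp [h l hl]) hc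
  simpa using this

theorem eq_of_supported {M : Type*} [AddCommGroup M] [Module K M] {s : Set (List X)}
    (F G : ListChain K X →ₗ[K] M)
    (h : ∀ l ∈ s, F (Finsupp.single l 1) = G (Finsupp.single l 1)) {c : ListChain K X}
    (hc : c ∈ Finsupp.supported K K s) : F c = G c := by
  have := eq_zero_of_supported (F - G) (fun l hl => by simp [h l hl]) hc
  simpa [sub_eq_zero] using this

/-- Prepend a fixed list to every list of a chain. -/
noncomputable def prepend (x : List X) : ListChain K X →ₗ[K] ListChain K X :=
  Finsupp.lmapDomain K K (x ++ ·)

/-- Apply a vertex map to a chain. -/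
noncomputable def map (φ : X → Y) : ListChain K X →ₗ[K] ListChain K Y :=
  Finsupp.lmapDomain K K (List.map φ)

/-- The cone operator with apex `a`. -/
noncomputable def cone (a : X) : ListChain K X →ₗ[K] ListChain K X :=
  Finsupp.lmapDomain K K (List.cons a)

/-- The boundary of a single list. -/
noncomputable def bdList (K : Type*) [Field K] : List X → ListChain K X
  | [] => 0
  | a :: l => Finsupp.single l 1 - cone a (bdList K l)

/-- The boundary operator: the alternating sum of the deletions of one entry. -/
noncomputable def bd : ListChain K X →ₗ[K] ListChain K X :=
  Finsupp.linearCombination K (bdList K)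

@[simp] theorem prepend_single (x l : List X) (r : K) :
    prepend x (Finsupp.single l r) = Finsupp.single (x ++ l) r := by simp [prepend]

@[simp] theorem map_single (φ : X → Y) (l : List X) (r : K) :
    map φ (Finsupp.single l r) = Finsupp.single (l.map φ) r := by simp [map]

@[simp] theorem cone_single (a : X) (l : List X) (r : K) :
    cone a (Finsupp.single l r) = Finsupp.single (a :: l) r := by simp [cone]

@[simp] theorem bd_single (l : List X) : bd (Finsupp.single l (1 : K)) = bdList K l := by
  simp [bd]

theorem hom_ext {M : Type*} [AddCommGroup M] [Module K M] {F G : ListChain K X →ₗ[K] M}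
    (h : ∀ l, F (Finsupp.single l 1) = G (Finsupp.single l 1)) : F = G :=
  Finsupp.lhom_ext' fun l => LinearMap.ext_ring (h l)

theorem bd_cone (a : X) (c : ListChain K X) : bd (cone a c) = c - cone a (bd c) := by
  have : bd ∘ₗ cone a = LinearMap.id - cone a ∘ₗ (bd : ListChain K X →ₗ[K] _) :=
    hom_ext fun l => by simp [bdList]
  exact LinearMap.congr_fun this c

theorem bd_bd (c : ListChain K X) : bd (bd c) = 0 := by
  have : bd ∘ₗ bd = (0 : ListChain K X →ₗ[K] ListChain K X) := by
    refine hom_ext fun l => ?_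
    induction l with
    | nil => simp [bdList]
    | cons a l ih =>
      simp only [LinearMap.comp_apply, bd_single, LinearMap.zero_apply] at ih ⊢
      simp [bdList, bd_cone, ih]
  exact LinearMap.congr_fun this c

theorem map_cone (φ : X → Y) (a : X) (c : ListChain K X) :
    map φ (cone a c) = cone (φ a) (map φ c) := by
  have : map φ ∘ₗ cone a = cone (φ a) ∘ₗ (map φ : ListChain K X →ₗ[K] _) :=
    hom_ext fun l => by simp
  exact LinearMap.congr_fun this c

theorem map_bd (φ : X → Y) (c : ListChain K X) : map φ (bd c) = bd (map φ c) := by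
  have : map φ ∘ₗ bd = bd ∘ₗ (map φ : ListChain K X →ₗ[K] _) := by
    refine hom_ext fun l => ?_
    induction l with
    | nil => simp [bdList]
    | cons a l ih =>
      simp only [LinearMap.comp_apply, bd_single, map_single] at ih ⊢
      simp [bdList, map_cone, ih]
  exact LinearMap.congr_fun this c

theorem bdList_mem (l : List X) :
    bdList K l ∈ Finsupp.supported K K {l' | l'.Sublist l ∧ l'.length + 1 = l.length} := by
  induction l with
  | nil => simp [bdList]
  | cons a l ih =>
    refine Submodule.sub_mem _ (Finsupp.single_mem_supported K _ ?_) ?_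
    · simp
    · refine map_mem_of_supported (cone a) (fun l' hl' => ?_) ih
      rw [cone_single]
      refine Finsupp.single_mem_supported K _ ?_
      simpa using hl'

theorem bdList_append (x l : List X) :
    bdList K (x ++ l) = Finsupp.lmapDomain K K (· ++ l) (bdList K x)
      + (-1 : K) ^ x.length • prepend x (bdList K l) := by
  have key : ∀ (a : X) (x : List X) (c : ListChain K X),
      cone a (prepend x c) = prepend (a :: x) c := fun a x c => by
    have : cone a ∘ₗ prepend x = (prepend (a :: x) : ListChain K X →ₗ[K] _) :=
      hom_ext fun l => by simp
    exact LinearMap.congr_fun this c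
  have key2 : ∀ (a : X) (c : ListChain K X),
      cone a (Finsupp.lmapDomain K K (· ++ l) c) =
        Finsupp.lmapDomain K K (· ++ l) (cone a c) := fun a c => by
    have : cone a ∘ₗ Finsupp.lmapDomain K K (· ++ l) =
        Finsupp.lmapDomain K K (· ++ l) ∘ₗ (cone a : ListChain K X →ₗ[K] _) :=
      hom_ext fun l => by simp
    exact LinearMap.congr_fun this c
  induction x with
  | nil =>
    have : prepend (K := K) ([] : List X) = LinearMap.id := hom_ext fun l => by simp
    simp [bdList, this]
  | cons a x ih =>
    simp only [List.cons_append, bdList, ih, map_add, map_sub, map_smul, key, key2,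
      List.length_cons, pow_succ]
    simp
    abel

section Extract

theorem eq_of_append_cons {x x' y y' : List X} {a : X} (hx : a ∉ x) (hx' : a ∉ x')
    (h : x ++ a :: y = x' ++ a :: y') : x = x' := by
  induction x generalizing x' with
  | nil =>
    cases x' with
    | nil => rfl
    | cons b x' => simp_all
  | cons b x ih =>
    cases x' with
    | nil => simp_all
    | cons b' x' =>
      simp only [List.cons_append, List.cons.injEq, List.mem_cons, not_or] at h hx hx'
      rw [h.1, ih hx.2 hx'.2 h.2]

/-- The coefficient chain of the lists of the form `x ++ a :: y`. -/
noncomputable def extract (x : List X) (a : X) : ListChain K X →ₗ[K] ListChain K X :=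
  Finsupp.lcomapDomain (fun y => x ++ a :: y) fun y z h => by simpa using h

theorem extract_apply (x : List X) (a : X) (c : ListChain K X) (y : List X) :
    extract x a c y = c (x ++ a :: y) := rfl

theorem extract_single_of_ne {x : List X} {a : X} {l : List X} (r : K)
    (h : ∀ y, l ≠ x ++ a :: y) : extract x a (Finsupp.single l r) = 0 := by
  ext y
  simp [extract_apply, h y]

theorem extract_single_self (x : List X) (a : X) (y : List X) (r : K) :
    extract x a (Finsupp.single (x ++ a :: y) r) = Finsupp.single y r := by
  ext z
  classical
  simp only [extract_apply, Finsupp.single_apply, List.append_cancel_left_eq, List.cons.injEq,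
    true_and]

theorem extract_prepend_cone_self (x : List X) (a : X) (c : ListChain K X) :
    extract x a (prepend x (cone a c)) = c := by
  have : extract x a ∘ₗ prepend x ∘ₗ cone a = (LinearMap.id : ListChain K X →ₗ[K] _) :=
    hom_ext fun l => by simp [extract_single_self]
  exact LinearMap.congr_fun this c

theorem extract_prepend_cone_of_ne {x x' : List X} {a : X} (hx : a ∉ x) (hx' : a ∉ x')
    (h : x' ≠ x) (c : ListChain K X) : extract x a (prepend x' (cone a c)) = 0 := by
  have : extract x a ∘ₗ prepend x' ∘ₗ cone a = (0 : ListChain K X →ₗ[K] ListChain K X) := by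
    refine hom_ext fun l => ?_
    simp only [LinearMap.comp_apply, cone_single, prepend_single, LinearMap.zero_apply]
    refine extract_single_of_ne _ fun y hy => h ?_
    exact eq_of_append_cons hx' hx hy
  exact LinearMap.congr_fun this c

theorem extract_bd {x : List X} {a : X} (hx : a ∉ x) {c : ListChain K X}
    (hc : c ∈ Finsupp.supported K K {l | l.Nodup ∧ a ∉ l.drop (x.length + 1)}) :
    extract x a (bd c) = (-1 : K) ^ (x.length + 1) • bd (extract x a c) := by
  rw [← LinearMap.comp_apply, ← LinearMap.comp_apply, ← LinearMap.smul_apply]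
  refine eq_of_supported _ _ (fun l hl => ?_) hc
  obtain ⟨hnd, hpos⟩ := hl
  simp only [LinearMap.comp_apply, LinearMap.smul_apply, bd_single]
  by_cases hal : a ∈ l
  · obtain ⟨x', y', rfl⟩ := List.append_of_mem hal
    have hnd' := List.nodup_middle.1 hnd
    have hx' : a ∉ x' := fun h => (List.nodup_cons.1 hnd').1 (by simp [h])
    have hy' : a ∉ y' := fun h => (List.nodup_cons.1 hnd').1 (by simp [h])
    rw [bdList_append, bdList]
    simp only [map_add, map_sub, map_smul, prepend_single]
    have h1 : extract x a (Finsupp.lmapDomain K K (· ++ a :: y') (bdList K x')) = 0 := by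
      rw [← LinearMap.comp_apply]
      refine eq_zero_of_supported _ (fun l' hl' => ?_) (bdList_mem x')
      rw [LinearMap.comp_apply, Finsupp.lmapDomain_apply, Finsupp.mapDomain_single]
      refine extract_single_of_ne _ fun y hy => ?_
      have h := eq_of_append_cons (fun h => hx' (hl'.1.subset h)) hx hy
      have hlen : x.length + 1 = x'.length := by rw [← h]; exact hl'.2
      apply hpos
      rw [hlen]
      simp
    have h2 : extract x a (Finsupp.single (x' ++ y') (1 : K)) = 0 :=
      extract_single_of_ne _ fun y hy => by
        have : a ∈ x' ++ y' := by rw [hy]; simp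
        simp [hx', hy'] at this
    rw [h1, h2]
    by_cases h : x' = x
    · subst h
      rw [extract_prepend_cone_self, extract_single_self, bd_single, pow_succ]
      simp
    · rw [extract_prepend_cone_of_ne hx hx' h, extract_single_of_ne]
      · simp
      · intro y hy
        exact h (eq_of_append_cons hx' hx hy)
  · rw [extract_single_of_ne (l := l) _ (fun y hy => hal (by rw [hy]; simp))]
    simp only [map_zero, smul_zero]
    refine eq_zero_of_supported _ (fun l' hl' => ?_) (bdList_mem l)
    exact extract_single_of_ne _ (fun y hy => hal (hl'.1.subset (by rw [hy]; simp)))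

end Extract

section InjectiveWords

/-- Chains of injective words of length `r` with letters in `S`. -/
noncomputable def words (K : Type*) [Field K] (S : Finset X) (r : ℕ) :
    Submodule K (ListChain K X) :=
  Finsupp.supported K K {l | l.Nodup ∧ (∀ b ∈ l, b ∈ S) ∧ l.length = r}

theorem bd_mem_words {S : Finset X} {r : ℕ} {c : ListChain K X} (hc : c ∈ words K S (r + 1)) :
    bd c ∈ words K S r := by
  refine map_mem_of_supported bd (fun l hl => ?_) hc
  rw [bd_single]
  refine Finsupp.supported_mono ?_ (bdList_mem l)
  rintro l' ⟨h1, h2⟩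
  exact ⟨hl.1.sublist h1, fun b hb => hl.2.1 b (h1.subset hb), by have := hl.2.2; omega⟩

theorem exists_bd_eq_of_head {S : Finset X} {a : X} (ha : a ∈ S) {r : ℕ} {c : ListChain K X}
    (hc : c ∈ words K S r) (hpos : c ∈ Finsupp.supported K K {l | a ∉ l.drop 1})
    (hbd : bd c = 0) : ∃ z ∈ words K S (r + 1), bd z = c := by
  set u := extract [] a c with hu
  set v := c - cone a u with hv
  have hcs : c ∈ Finsupp.supported K K
      {l | (l.Nodup ∧ (∀ b ∈ l, b ∈ S) ∧ l.length = r) ∧ a ∉ l.drop 1} :=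
    fun l hl => ⟨hc hl, hpos hl⟩
  have hvs : v ∈ Finsupp.supported K K
      {l | (l.Nodup ∧ (∀ b ∈ l, b ∈ S) ∧ l.length = r) ∧ a ∉ l} := by
    refine map_mem_of_supported (LinearMap.id - cone a ∘ₗ extract [] a) (fun l hl => ?_) hcs
    obtain ⟨hl, hal⟩ := hl
    simp only [LinearMap.sub_apply, LinearMap.id_apply, LinearMap.comp_apply]
    by_cases h : ∃ y, l = [] ++ a :: y
    · obtain ⟨y, rfl⟩ := h
      rw [extract_single_self, cone_single]
      simp
    · push Not at h
      rw [extract_single_of_ne _ h, map_zero, sub_zero]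
      refine Finsupp.single_mem_supported K _ ⟨hl, ?_⟩
      cases l with
      | nil => simp
      | cons b l =>
        have hb : a ≠ b := fun hb => h l (by simp [hb])
        simpa [hb] using hal
  have hus : u ∈ Finsupp.supported K K {l | a ∉ l} := by
    intro l hl
    have this : u l ≠ 0 := Finsupp.mem_support_iff.1 hl
    rw [hu, extract_apply] at this
    simpa using (hcs (Finsupp.mem_support_iff.2 this)).2
  have hcu : c = cone a u + v := by simp [hv]
  have hfree : u + bd v = 0 := by
    have h1 : u + bd v = cone a (bd u) := by
      rw [hcu, map_add, bd_cone] at hbd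
      rw [← sub_eq_zero, ← hbd]
      abel
    have h2 : u + bd v ∈ Finsupp.supported K K {l | a ∉ l} := by
      refine Submodule.add_mem _ hus (map_mem_of_supported bd (fun l hl => ?_) hvs)
      rw [bd_single]
      exact Finsupp.supported_mono (fun l' (hl' : _ ∧ _) (h : a ∈ l') => hl.2 (hl'.1.subset h))
        (bdList_mem l)
    have h3 : u + bd v ∈ Finsupp.supported K K {l | a ∈ l} := by
      rw [h1]
      refine map_mem_of_supported (s := Set.univ) (cone (K := K) a) (fun l _ => ?_) (by simp)
      rw [cone_single]
      exact Finsupp.single_mem_supported K _ (by simp)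
    have hd : Disjoint {l : List X | a ∉ l} {l | a ∈ l} :=
      Set.disjoint_left.2 fun l h h' => h h'
    exact Submodule.disjoint_def.1 (Finsupp.disjoint_supported_supported hd) _ h2 h3
  refine ⟨cone a v, ?_, ?_⟩
  · refine map_mem_of_supported (cone a) (fun l hl => ?_) hvs
    rw [cone_single]
    refine Finsupp.single_mem_supported K _ ⟨?_, ?_, ?_⟩
    · exact List.nodup_cons.2 ⟨hl.2, hl.1.1⟩
    · rintro b (_ | ⟨_, hb⟩)
      exacts [ha, hl.1.2.1 b hb]
    · simp [hl.1.2.2]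
  · rw [bd_cone, eq_neg_of_add_eq_zero_right hfree, hcu, map_neg]
    abel

theorem extract_mem_supported {x : List X} {a : X} {s : Set (List X)} {c : ListChain K X}
    (hc : c ∈ Finsupp.supported K K s) :
    extract x a c ∈ Finsupp.supported K K {y | x ++ a :: y ∈ s} := by
  intro y hy
  have h : extract x a c y ≠ 0 := Finsupp.mem_support_iff.1 hy
  rw [extract_apply] at h
  exact hc (Finsupp.mem_support_iff.2 h)

theorem bd_mem_supported_drop {a : X} {n : ℕ} {c : ListChain K X}
    (hc : c ∈ Finsupp.supported K K {l | a ∉ l.drop n}) :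
    bd c ∈ Finsupp.supported K K {l | a ∉ l.drop n} := by
  refine map_mem_of_supported bd (fun l hl => ?_) hc
  rw [bd_single]
  refine Finsupp.supported_mono ?_ (bdList_mem l)
  intro l' hl' h
  exact hl ((hl'.1.drop n).subset h)

/-- The complex of injective words is exact below its top degree. -/
theorem exists_bd_eq_of_card [DecidableEq X] (m : ℕ) :
    ∀ (S : Finset X), S.card = m → ∀ r < m, ∀ c ∈ words K S r, bd c = 0 →
      ∃ z ∈ words K S (r + 1), bd z = c := by
  induction m using Nat.strong_induction_on with
  | _ m ih =>
  intro S hS r hr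
  obtain ⟨a, ha⟩ : S.Nonempty := Finset.card_pos.1 (by omega)
  have main : ∀ j : ℕ, ∀ c ∈ words K S r,
      c ∈ Finsupp.supported K K {l | a ∉ l.drop (j + 1)} → bd c = 0 →
      ∃ z ∈ words K S (r + 1), bd z = c := by
    intro j
    induction j with
    | zero => exact fun c hc hpos hbd => exists_bd_eq_of_head ha hc hpos hbd
    | succ j ihj =>
      intro c hc hpos hbd
      have hcs : ∀ l, c l ≠ 0 → (l.Nodup ∧ (∀ b ∈ l, b ∈ S) ∧ l.length = r) ∧
          a ∉ l.drop (j + 1 + 1) :=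
        fun l hl => ⟨hc (Finsupp.mem_support_iff.2 hl), hpos (Finsupp.mem_support_iff.2 hl)⟩
      have hfill : ∀ x : List X, ∃ z : ListChain K X, x.length = j + 1 → a ∉ x →
          (prepend x (cone a z) ∈ words K S (r + 1) ∧
          prepend x (cone a z) ∈ Finsupp.supported K K {l | a ∉ l.drop (j + 1 + 1)} ∧
          bd z = extract x a c) := by
        intro x
        by_cases hy : extract x a c = 0
        · exact ⟨0, fun _ _ => by simp [hy]⟩
        by_cases hx : x.length = j + 1 ∧ a ∉ x
        swap
        · exact ⟨0, fun h1 h2 => absurd ⟨h1, h2⟩ hx⟩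
        obtain ⟨hxl, hxa⟩ := hx
        obtain ⟨y₀, hy₀⟩ := Finsupp.ne_iff.1 hy
        have h0 := (hcs _ hy₀).1
        have hxS : ∀ b ∈ x, b ∈ S := fun b hb => h0.2.1 b (by simp [hb])
        have hxnd : (a :: x).Nodup :=
          (List.nodup_middle.1 h0.1).sublist ((List.sublist_append_left x y₀).cons_cons a)
        have hlen : r = j + 2 + y₀.length := by
          rw [← h0.2.2]
          simp
          omega
        set S' := S \ (a :: x).toFinset with hS'
        have hcard : S'.card = m - (j + 2) := by
          rw [hS', Finset.card_sdiff_of_subset, List.toFinset_card_of_nodup hxnd, hS]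
          · simp [hxl]
          · intro b hb
            simp only [List.mem_toFinset, List.mem_cons] at hb
            rcases hb with rfl | hb
            exacts [ha, hxS b hb]
        have hyw : extract x a c ∈ words K S' y₀.length := by
          refine Finsupp.supported_mono ?_ (extract_mem_supported (x := x) (a := a) hc)
          rintro y ⟨h1, h2, h3⟩
          have h1' := List.nodup_middle.1 h1
          refine ⟨((List.nodup_append.1 (List.nodup_cons.1 h1').2).2.1), fun b hb => ?_, ?_⟩
          · rw [hS', Finset.mem_sdiff]
            refine ⟨h2 b (by simp [hb]), fun hb' => ?_⟩
            simp only [List.mem_toFinset, List.mem_cons] at hb'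
            rcases hb' with rfl | hb'
            · exact (List.nodup_cons.1 h1').1 (by simp [hb])
            · exact (List.nodup_append.1 (List.nodup_cons.1 h1').2).2.2 b hb' b hb rfl
          · simp only [List.length_append, List.length_cons] at h3
            omega
        have hyb : bd (extract x a c) = 0 := by
          have h := extract_bd (K := K) hxa (c := c) (by
            rw [hxl]
            exact fun l hl => ⟨(hc hl).1, hpos hl⟩)
          rw [hbd, map_zero] at h
          exact (smul_eq_zero.1 h.symm).resolve_left (pow_ne_zero _ (neg_ne_zero.2 one_ne_zero))
        obtain ⟨z, hz, hzb⟩ := ih (m - (j + 2)) (by omega) S' hcard y₀.length (by omega) _ hyw hyb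
        refine ⟨z, fun _ _ => ⟨?_, ?_, hzb⟩⟩
        · rw [← LinearMap.comp_apply]
          refine map_mem_of_supported _ (fun l hl => ?_) hz
          rw [LinearMap.comp_apply, cone_single, prepend_single]
          obtain ⟨h1, h2, h3⟩ := hl
          simp only [hS', Finset.mem_sdiff, List.mem_toFinset] at h2
          refine Finsupp.single_mem_supported K _ ⟨?_, ?_, ?_⟩
          · rw [List.nodup_middle, ← List.cons_append]
            refine List.nodup_append.2 ⟨hxnd, h1, ?_⟩
            rintro b hb _ hb' rfl
            exact (h2 b hb').2 hb
          · intro b hb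
            simp only [List.mem_append, List.mem_cons] at hb
            rcases hb with hb | rfl | hb
            exacts [hxS b hb, ha, (h2 b hb).1]
          · simp only [List.length_append, List.length_cons, h3]
            omega
        · rw [← LinearMap.comp_apply]
          refine map_mem_of_supported _ (fun l hl => ?_) hz
          rw [LinearMap.comp_apply, cone_single, prepend_single]
          refine Finsupp.single_mem_supported K _ ?_
          have : (x ++ a :: l).drop (j + 1 + 1) = l := by
            rw [← hxl, List.drop_append]
            simp
          rw [Set.mem_ofPred_eq, this]
          intro hal
          have := (hl.2.1 a hal)
          simp [hS'] at this
      choose z hz using hfill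
      set I : Finset (List X) :=
        (c.support.image (List.take (j + 1))).filter (fun x => x.length = j + 1 ∧ a ∉ x) with hI
      set Z : ListChain K X := ∑ x ∈ I, (-1 : K) ^ j • prepend x (cone a (z x)) with hZ
      have hZw : Z ∈ words K S (r + 1) := Submodule.sum_mem _ fun x hx =>
        Submodule.smul_mem _ _ (hz x (Finset.mem_filter.1 hx).2.1 (Finset.mem_filter.1 hx).2.2).1
      have hZd : Z ∈ Finsupp.supported K K {l | a ∉ l.drop (j + 1 + 1)} :=
        Submodule.sum_mem _ fun x hx => Submodule.smul_mem _ _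
          (hz x (Finset.mem_filter.1 hx).2.1 (Finset.mem_filter.1 hx).2.2).2.1
      have hZx : ∀ x, x.length = j + 1 → a ∉ x → extract x a (bd Z) = extract x a c := by
        intro x hxl hxa
        rw [extract_bd hxa (by rw [hxl]; exact fun l hl => ⟨(hZw hl).1, hZd hl⟩), hZ, map_sum]
        by_cases hxI : x ∈ I
        · rw [Finset.sum_eq_single x]
          · rw [map_smul, extract_prepend_cone_self, map_smul, (hz x hxl hxa).2.2, smul_smul,
              ← pow_add, hxl, show j + 1 + 1 + j = 2 * (j + 1) by ring, pow_mul]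
            simp
          · intro x' hx' hne
            rw [map_smul, extract_prepend_cone_of_ne hxa (Finset.mem_filter.1 hx').2.2 hne,
              smul_zero]
          · exact fun h => absurd hxI h
        · rw [Finset.sum_eq_zero]
          · rw [map_zero, smul_zero]
            ext y
            rw [extract_apply, Finsupp.zero_apply]
            by_contra hne
            refine hxI (Finset.mem_filter.2 ⟨Finset.mem_image.2 ⟨x ++ a :: y,
              Finsupp.mem_support_iff.2 (Ne.symm hne), ?_⟩, hxl, hxa⟩)
            rw [← hxl]
            simp
          · intro x' hx'
            rw [map_smul, extract_prepend_cone_of_ne hxa (Finset.mem_filter.1 hx').2.2, smul_zero]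
            rintro rfl
            exact hxI hx'
      have hc'w : c - bd Z ∈ words K S r := Submodule.sub_mem _ hc (bd_mem_words hZw)
      have hc'd : c - bd Z ∈ Finsupp.supported K K {l | a ∉ l.drop (j + 1 + 1)} :=
        Submodule.sub_mem _ hpos (bd_mem_supported_drop hZd)
      obtain ⟨z', hz', hz'b⟩ := ihj (c - bd Z) hc'w (fun l hl => by
        intro hal
        have hnd : l.Nodup := (hc'w hl).1
        have hlt : j + 1 < l.length := by
          by_contra h
          rw [List.drop_eq_nil_of_le (by omega)] at hal
          simp at hal
        have h2 : a ∉ l.drop (j + 1 + 1) := hc'd hl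
        rw [List.drop_eq_getElem_cons hlt, List.mem_cons] at hal
        have h3 := hal.resolve_right h2
        have hl' : l = l.take (j + 1) ++ a :: l.drop (j + 1 + 1) := by
          rw [h3, ← List.drop_eq_getElem_cons hlt, List.take_append_drop]
        have h4 : a ∉ l.take (j + 1) := fun h => by
          rw [hl', List.nodup_middle] at hnd
          exact (List.nodup_cons.1 hnd).1 (by simp [h])
        have h5 := DFunLike.congr_fun (hZx (l.take (j + 1)) (by simp; omega) h4)
          (l.drop (j + 1 + 1))
        rw [extract_apply, extract_apply, ← hl'] at h5
        refine Finsupp.mem_support_iff.1 hl ?_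
        rw [Finsupp.sub_apply, h5, sub_self]) (by rw [map_sub, hbd, bd_bd, sub_zero])
      exact ⟨z' + Z, Submodule.add_mem _ hz' hZw, by rw [map_add, hz'b, sub_add_cancel]⟩
  intro c hc hbd
  refine main r c hc (fun l hl => ?_) hbd
  have : l.length = r := (hc hl).2.2
  simp [List.drop_eq_nil_of_le (show l.length ≤ r + 1 by omega)]

end InjectiveWords

section Subdivision

variable {E F : Type*} [NormedAddCommGroup E] [NormedSpace ℝ E]
  [NormedAddCommGroup F] [NormedSpace ℝ F]

/-- The barycenter of a list of points. -/
noncomputable def bary (l : List E) : E := (l.length : ℝ)⁻¹ • l.sum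

/-- The barycentric subdivision of a list of length `n`. -/
noncomputable def sdList (K : Type*) [Field K] : ℕ → List E → ListChain K E
  | 0, _ => Finsupp.single [] 1
  | n + 1, l => cone (bary l) (Finsupp.linearCombination K (sdList K n) (bdList K l))

/-- Barycentric subdivision of chains. -/
noncomputable def sd : ListChain K E →ₗ[K] ListChain K E :=
  Finsupp.linearCombination K fun l => sdList K l.length l

theorem sd_single_nil : sd (Finsupp.single ([] : List E) (1 : K)) = Finsupp.single [] 1 := by
  simp [sd, sdList]

theorem sd_single {l : List E} (hl : l ≠ []) :
    sd (Finsupp.single l (1 : K)) = cone (bary l) (sd (bdList K l)) := by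
  obtain ⟨n, hn⟩ : ∃ n, l.length = n + 1 :=
    Nat.exists_eq_succ_of_ne_zero (by simpa using hl)
  have : sd (Finsupp.single l (1 : K)) = sdList K l.length l := by simp [sd]
  rw [this, hn, sdList]
  congr 1
  refine eq_of_supported _ _ (fun l' hl' => ?_) (bdList_mem l)
  have : l'.length = n := by have := hl'.2; omega
  simp [sd, this]

/-- Induction on the length of a list through the faces occurring in its boundary. -/
theorem face_induction {P : List X → Prop} (nil : P [])
    (step : ∀ l, l ≠ [] → (∀ l', l'.Sublist l → l'.length + 1 = l.length → P l') → P l)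
    (l : List X) : P l := by
  induction h : l.length generalizing l with
  | zero => rwa [List.length_eq_zero_iff.1 h]
  | succ n ih => exact step l (by rintro rfl; simp at h) fun l' _ hl' => ih l' (by omega)

theorem bd_sd (c : ListChain K E) : bd (sd c) = sd (bd c) := by
  have : bd ∘ₗ sd = sd ∘ₗ (bd : ListChain K E →ₗ[K] _) := by
    refine hom_ext fun l => ?_
    simp only [LinearMap.comp_apply]
    induction l using face_induction with
    | nil => simp [sd_single_nil, bdList]
    | step l hl ih =>
      have h : bd (sd (bdList K l)) = sd (bd (bdList K l)) := by
        rw [← LinearMap.comp_apply, ← LinearMap.comp_apply]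
        exact eq_of_supported _ _ (fun l' hl' => ih l' hl'.1 hl'.2) (bdList_mem l)
      rw [sd_single hl, bd_cone, h, bd_single, ← bd_single l, bd_bd]
      simp
  exact LinearMap.congr_fun this c

theorem map_sd (T : E →ₗ[ℝ] F) (c : ListChain K E) : map T (sd c) = sd (map T c) := by
  have hb : ∀ l : List E, T (bary l) = bary (l.map T) := fun l => by
    simp [bary, map_list_sum]
  have : map T ∘ₗ sd = sd ∘ₗ (map T : ListChain K E →ₗ[K] _) := by
    refine hom_ext fun l => ?_
    simp only [LinearMap.comp_apply]
    induction l using face_induction with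
    | nil => simp [sd_single_nil]
    | step l hl ih =>
      have h : map T (sd (bdList K l)) = sd (map T (bdList K l)) := by
        rw [← LinearMap.comp_apply, ← LinearMap.comp_apply]
        exact eq_of_supported _ _ (fun l' hl' => ih l' hl'.1 hl'.2) (bdList_mem l)
      rw [sd_single hl, map_cone, h, map_single, sd_single (by simpa using hl), hb, ← bd_single,
        map_bd, map_single, bd_single]
  exact LinearMap.congr_fun this c

theorem bary_mem {s : Set E} (hs : Convex ℝ s) {l : List E} (hl : l ≠ []) (h : ∀ x ∈ l, x ∈ s) :
    bary l ∈ s := by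
  have h0 : (l.length : ℝ) ≠ 0 := by simpa using hl
  have := hs.sum_mem (t := Finset.univ) (w := fun _ : Fin l.length => (l.length : ℝ)⁻¹)
    (z := fun i => l[i]) (fun _ _ => by positivity) (by simp [h0])
    (fun i _ => h _ (List.getElem_mem _))
  rw [← Finset.smul_sum] at this
  simpa [bary, Fin.sum_univ_getElem] using this

theorem sd_mem_of_convex {s : Set E} (hs : Convex ℝ s) {l : List E} (h : ∀ x ∈ l, x ∈ s) :
    sd (Finsupp.single l (1 : K)) ∈
      Finsupp.supported K K {l' | l'.length = l.length ∧ ∀ x ∈ l', x ∈ s} := by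
  induction l using face_induction with
  | nil =>
    rw [sd_single_nil]
    exact Finsupp.single_mem_supported K _ ⟨rfl, by simp⟩
  | step l hl ih =>
    rw [sd_single hl]
    have h1 : sd (bdList K l) ∈
        Finsupp.supported K K {l' | l'.length + 1 = l.length ∧ ∀ x ∈ l', x ∈ s} := by
      refine map_mem_of_supported (sd (K := K)) (fun l' hl' => ?_) (bdList_mem l)
      refine Finsupp.supported_mono ?_ (ih l' hl'.1 hl'.2 fun x hx => h x (hl'.1.subset hx))
      rintro l'' ⟨h1, h2⟩
      exact ⟨by rw [h1]; exact hl'.2, h2⟩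
    refine map_mem_of_supported (cone _) (fun l' hl' => ?_) h1
    rw [cone_single]
    refine Finsupp.single_mem_supported K _ ⟨hl'.1, ?_⟩
    rintro x (_ | ⟨_, hx⟩)
    exacts [bary_mem hs hl h, hl'.2 x hx]

theorem norm_bary_sub_le {l : List E} {v : E} (hv : v ∈ l) {ρ : ℝ}
    (h : ∀ x ∈ l, dist x v ≤ ρ) : dist v (bary l) ≤ (1 - (l.length : ℝ)⁻¹) * ρ := by
  have aux : ∀ l : List E, (∀ x ∈ l, dist x v ≤ ρ) →
      ‖l.sum - (l.length : ℝ) • v‖ ≤ l.length * ρ := by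
    intro l
    induction l with
    | nil => simp
    | cons a l ih =>
      intro h
      have h1 := ih fun x hx => h x (by simp [hx])
      have h2 : ‖a - v‖ ≤ ρ := by rw [← dist_eq_norm]; exact h a (by simp)
      have : (a :: l).sum - ((a :: l).length : ℝ) • v =
          (a - v) + (l.sum - (l.length : ℝ) • v) := by
        simp only [List.sum_cons, List.length_cons, Nat.cast_add, Nat.cast_one, add_smul, one_smul]
        abel
      rw [this]
      refine (norm_add_le _ _).trans ?_
      push_cast [List.length_cons]
      linarith
  obtain ⟨s, t, rfl⟩ := List.append_of_mem hv
  have h1 := aux (s ++ t) fun x hx => h x (by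
    simp only [List.mem_append, List.mem_cons] at hx ⊢
    tauto)
  set m := (s ++ t).length with hm
  have hlen : (s ++ v :: t).length = m + 1 := by simp [hm]; omega
  have hsum : (s ++ v :: t).sum = (s ++ t).sum + v := by
    simp only [List.sum_append, List.sum_cons]
    abel
  have h0 : ((m : ℝ) + 1) ≠ 0 := by positivity
  have hd : bary (s ++ v :: t) - v = ((m : ℝ) + 1)⁻¹ • ((s ++ t).sum - (m : ℝ) • v) := by
    rw [bary, hlen, hsum]
    push_cast
    match_scalars <;> field_simp
    ring
  rw [dist_comm, dist_eq_norm, hd, norm_smul, hlen]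
  rw [Real.norm_of_nonneg (by positivity)]
  push_cast
  have : (1 - ((m : ℝ) + 1)⁻¹) * ρ = ((m : ℝ) + 1)⁻¹ * (m * ρ) := by field_simp; ring
  rw [this]
  gcongr

theorem sd_mem_of_dist_le {N : ℕ} {l : List E} (hN : l.length ≤ N) {ρ : ℝ} (hρ : 0 ≤ ρ)
    (h : ∀ x ∈ l, ∀ y ∈ l, dist x y ≤ ρ) :
    sd (Finsupp.single l (1 : K)) ∈
      Finsupp.supported K K {l' | l'.length = l.length ∧
        ∀ x ∈ l', ∀ y ∈ l', dist x y ≤ (1 - (N : ℝ)⁻¹) * ρ} := by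
  induction l using face_induction with
  | nil =>
    rw [sd_single_nil]
    exact Finsupp.single_mem_supported K _ ⟨rfl, by simp⟩
  | step l hl ih =>
    have hpos : 0 < l.length := List.length_pos_iff.2 hl
    have hN' : (N : ℝ)⁻¹ ≤ (l.length : ℝ)⁻¹ := by gcongr
    have hN1 : (N : ℝ)⁻¹ ≤ 1 := by
      apply inv_le_one_of_one_le₀
      exact_mod_cast (by omega : 1 ≤ N)
    have hr : 0 ≤ (1 - (N : ℝ)⁻¹) * ρ := mul_nonneg (by linarith) hρ
    have hball : ∀ x ∈ l, x ∈ Metric.closedBall (bary l) ((1 - (N : ℝ)⁻¹) * ρ) := fun x hx =>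
      (norm_bary_sub_le hx fun y hy => h y hy x hx).trans (by gcongr)
    rw [sd_single hl]
    have h1 : sd (bdList K l) ∈ Finsupp.supported K K {l' | (l'.length + 1 = l.length ∧
        ∀ x ∈ l', ∀ y ∈ l', dist x y ≤ (1 - (N : ℝ)⁻¹) * ρ) ∧
        ∀ x ∈ l', x ∈ Metric.closedBall (bary l) ((1 - (N : ℝ)⁻¹) * ρ)} := by
      refine map_mem_of_supported (sd (K := K)) (fun l' hl' => ?_) (bdList_mem l)
      have hs := sd_mem_of_convex (K := K) (convex_closedBall (bary l) ((1 - (N : ℝ)⁻¹) * ρ))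
        (l := l') fun x hx => hball x (hl'.1.subset hx)
      have hd := ih l' hl'.1 hl'.2 (by have := hl'.2; omega)
        fun x hx y hy => h x (hl'.1.subset hx) y (hl'.1.subset hy)
      intro l'' hl''
      exact ⟨⟨by rw [(hd hl'').1]; exact hl'.2, (hd hl'').2⟩, (hs hl'').2⟩
    refine map_mem_of_supported (cone _) (fun l' hl' => ?_) h1
    rw [cone_single]
    refine Finsupp.single_mem_supported K _ ⟨hl'.1.1, ?_⟩
    intro x hx y hy
    rcases List.mem_cons.1 hx with rfl | hx <;> rcases List.mem_cons.1 hy with rfl | hy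
    · simpa using hr
    · rw [dist_comm]
      exact hl'.2 y hy
    · exact hl'.2 x hx
    · exact hl'.1.2 x hx y hy

/-- Iterated barycentric subdivision. -/
noncomputable def iterSd (R : ℕ) : ListChain K E →ₗ[K] ListChain K E := sd ^ R

theorem iterSd_zero (c : ListChain K E) : iterSd 0 c = c := by simp [iterSd]

theorem iterSd_succ (R : ℕ) (c : ListChain K E) : iterSd (R + 1) c = sd (iterSd R c) := by
  simp [iterSd, pow_succ']

theorem bd_iterSd (R : ℕ) (c : ListChain K E) : bd (iterSd R c) = iterSd R (bd c) := by
  induction R with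
  | zero => simp [iterSd_zero]
  | succ R ih => rw [iterSd_succ, iterSd_succ, bd_sd, ih]

theorem map_iterSd (T : E →ₗ[ℝ] F) (R : ℕ) (c : ListChain K E) :
    map T (iterSd R c) = iterSd R (map T c) := by
  induction R with
  | zero => simp [iterSd_zero]
  | succ R ih => rw [iterSd_succ, iterSd_succ, map_sd, ih]

theorem iterSd_single_nil (R : ℕ) :
    iterSd R (Finsupp.single ([] : List E) (1 : K)) = Finsupp.single [] 1 := by
  induction R with
  | zero => simp [iterSd_zero]
  | succ R ih => rw [iterSd_succ, ih, sd_single_nil]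

theorem iterSd_mem_of_convex {s : Set E} (hs : Convex ℝ s) (R : ℕ) {l : List E}
    (h : ∀ x ∈ l, x ∈ s) :
    iterSd R (Finsupp.single l (1 : K)) ∈
      Finsupp.supported K K {l' | l'.length = l.length ∧ ∀ x ∈ l', x ∈ s} := by
  induction R with
  | zero =>
    rw [iterSd_zero]
    exact Finsupp.single_mem_supported K _ ⟨rfl, h⟩
  | succ R ih =>
    rw [iterSd_succ]
    refine map_mem_of_supported (sd (K := K)) (fun l' hl' => ?_) ih
    have := sd_mem_of_convex (K := K) hs hl'.2
    rwa [hl'.1] at this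

theorem iterSd_mem_of_dist_le {N : ℕ} (R : ℕ) {l : List E} (hN : l.length ≤ N) {ρ : ℝ}
    (hρ : 0 ≤ ρ) (h : ∀ x ∈ l, ∀ y ∈ l, dist x y ≤ ρ) :
    iterSd R (Finsupp.single l (1 : K)) ∈
      Finsupp.supported K K {l' | l'.length = l.length ∧
        ∀ x ∈ l', ∀ y ∈ l', dist x y ≤ (1 - (N : ℝ)⁻¹) ^ R * ρ} := by
  have h0 : (0 : ℝ) ≤ 1 - (N : ℝ)⁻¹ := by
    rw [sub_nonneg]
    exact Nat.cast_inv_le_one N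
  induction R with
  | zero =>
    rw [iterSd_zero]
    exact Finsupp.single_mem_supported K _ ⟨rfl, by simpa using h⟩
  | succ R ih =>
    rw [iterSd_succ]
    refine map_mem_of_supported (sd (K := K)) (fun l' hl' => ?_) ih
    have := sd_mem_of_dist_le (K := K) (hl'.1.trans_le hN) (by positivity) hl'.2
    rwa [hl'.1, ← mul_assoc, ← pow_succ'] at this

end Subdivision

section Cochains

/-- The coboundary of a function on lists. -/
noncomputable def coboundary (f : List X → K) (l : List X) : K :=
  Finsupp.linearCombination K f (bdList K l)

theorem coboundary_pairing (f : List X → K) (c : ListChain K X) :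
    Finsupp.linearCombination K (coboundary f) c = Finsupp.linearCombination K f (bd c) := by
  have : Finsupp.linearCombination K (coboundary f) = Finsupp.linearCombination K f ∘ₗ bd :=
    hom_ext fun l => by simp [coboundary]
  exact LinearMap.congr_fun this c

theorem coboundary_coboundary (f : List X → K) : coboundary (coboundary f) = 0 := by
  funext l
  rw [coboundary, coboundary_pairing, ← bd_single, bd_bd]
  simp

theorem linearCombination_cone (f : List X → K) (a : X) (c : ListChain K X) :
    Finsupp.linearCombination K f (cone a c) =
      Finsupp.linearCombination K (fun l => f (a :: l)) c := by
  have : Finsupp.linearCombination K f ∘ₗ cone a =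
      Finsupp.linearCombination K (fun l => f (a :: l)) := hom_ext fun l => by simp
  exact LinearMap.congr_fun this c

theorem linearCombination_map (f : List Y → K) (φ : X → Y) (c : ListChain K X) :
    Finsupp.linearCombination K f (map φ c) =
      Finsupp.linearCombination K (fun l => f (l.map φ)) c := by
  have : Finsupp.linearCombination K f ∘ₗ map φ =
      Finsupp.linearCombination K (fun l => f (l.map φ)) := hom_ext fun l => by simp
  exact LinearMap.congr_fun this c

theorem coboundary_cons (f : List X → K) (a : X) (l : List X) :
    coboundary f (a :: l) = f l - coboundary (fun l => f (a :: l)) l := by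
  simp [coboundary, bdList, linearCombination_cone]

theorem coboundary_map (f : List Y → K) (φ : X → Y) (l : List X) :
    coboundary f (l.map φ) = coboundary (fun l => f (l.map φ)) l := by
  rw [coboundary, coboundary, ← linearCombination_map, ← bd_single, ← bd_single, map_bd,
    map_single]

/-- Alternating functions on lists. -/
structure IsAlt (f : List X → K) : Prop where
  swap : ∀ l₁ a b l₂, f (l₁ ++ a :: b :: l₂) = -f (l₁ ++ b :: a :: l₂)
  dup : ∀ l₁ a l₂, f (l₁ ++ a :: a :: l₂) = 0

theorem IsAlt.tail {f : List X → K} (hf : IsAlt f) (a : X) : IsAlt fun l => f (a :: l) where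
  swap l₁ := hf.swap (a :: l₁)
  dup l₁ := hf.dup (a :: l₁)

theorem IsAlt.coboundary {f : List X → K} (hf : IsAlt f) : IsAlt (coboundary f) where
  swap l₁ a b l₂ := by
    induction l₁ generalizing f with
    | nil =>
      have : (fun l => f (a :: b :: l)) = -fun l => f (b :: a :: l) := by
        funext l
        exact hf.swap [] a b l
      simp only [List.nil_append, coboundary_cons, this]
      simp [ListChain.coboundary, Finsupp.linearCombination_apply, Finsupp.sum]
      ring
    | cons x l₁ ih =>
      have h1 := ih (hf.tail x)
      have h2 := hf.swap l₁ a b l₂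
      simp only [List.cons_append, coboundary_cons, h1, h2]
      ring
  dup l₁ a l₂ := by
    induction l₁ generalizing f with
    | nil =>
      have : (fun l => f (a :: a :: l)) = 0 := by
        funext l
        exact hf.dup [] a l
      simp only [List.nil_append, coboundary_cons, this]
      simp [ListChain.coboundary]
    | cons x l₁ ih =>
      have h1 := ih (hf.tail x)
      have h2 := hf.dup l₁ a l₂
      simp only [List.cons_append, coboundary_cons, h1, h2, sub_zero]

theorem IsAlt.eq_zero_of_not_nodup {f : List X → K} (hf : IsAlt f) {l : List X}
    (hl : ¬ l.Nodup) : f l = 0 := by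
  have aux : ∀ (l₂ l₁ : List X) (a : X) (l₃ : List X), f (l₁ ++ a :: (l₂ ++ a :: l₃)) = 0 := by
    intro l₂
    induction l₂ with
    | nil => exact fun l₁ a l₃ => hf.dup l₁ a l₃
    | cons b l₂ ih =>
      intro l₁ a l₃
      have := ih (l₁ ++ [b]) a l₃
      rw [List.append_assoc] at this
      simpa [hf.swap l₁ a b] using this
  induction l generalizing f with
  | nil => simp at hl
  | cons a l ih =>
    by_cases h : a ∈ l
    · obtain ⟨s, t, rfl⟩ := List.append_of_mem h
      exact aux s [] a t
    · refine ih (hf.tail a) (fun hn => hl (List.nodup_cons.2 ⟨h, hn⟩)) fun l₂ l₁ => aux l₂ (a :: l₁)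

theorem isAlt_map {f : List Y → K} (hf : IsAlt f) (φ : X → Y) :
    IsAlt fun l => f (l.map φ) where
  swap l₁ a b l₂ := by simpa using hf.swap (l₁.map φ) (φ a) (φ b) (l₂.map φ)
  dup l₁ a l₂ := by simpa using hf.dup (l₁.map φ) (φ a) (l₂.map φ)

theorem IsAlt.mul_toFinset [DecidableEq X] {f : List X → K} (hf : IsAlt f) (d : Finset X → K) :
    IsAlt fun l => d l.toFinset * f l where
  swap l₁ a b l₂ := by
    have : (l₁ ++ a :: b :: l₂).toFinset = (l₁ ++ b :: a :: l₂).toFinset := by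
      ext x
      simp only [List.mem_toFinset, List.mem_append, List.mem_cons]
      tauto
    rw [this, hf.swap]
    ring
  dup l₁ a l₂ := by rw [hf.dup, mul_zero]

end Cochains

section Weyl

variable {K M : Type*} [Field K] [AddCommGroup M] [Module K M]

theorem weyl_mem_pow {N : Submodule K M} {t : M →ₗ[K] M} (ht : ∀ m ∈ N, t m ∈ N) (r : ℕ) {m : M}
    (hm : m ∈ N) : (t ^ r) m ∈ N := by
  induction r with
  | zero => simpa
  | succ r ih =>
    rw [pow_succ']
    exact ht _ ih

variable {p : ℕ} [Fact p.Prime] [CharP K p] {N : Submodule K M} {t y : M →ₗ[K] M}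

theorem weyl_apply
    (hy : ∀ m ∈ N, y m ∈ N) (hty : ∀ m ∈ N, t (y m) = y (t m) + m)
    {m : M} (hm : m ∈ N) (h0 : t m = 0) (r : ℕ) :
    t ((y ^ (r + 1)) m) = ((r : K) + 1) • (y ^ r) m := by
  induction r with
  | zero => simp [hty m hm, h0]
  | succ r ih =>
    rw [pow_succ', Module.End.mul_apply, hty _ (weyl_mem_pow hy _ hm), ih, map_smul,
      ← Module.End.mul_apply, ← pow_succ']
    push_cast
    module

theorem weyl_pow_apply
    (hy : ∀ m ∈ N, y m ∈ N) (hty : ∀ m ∈ N, t (y m) = y (t m) + m)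
    {m : M} (hm : m ∈ N) (h0 : t m = 0) (r : ℕ) :
    (t ^ r) ((y ^ r) m) = (r.factorial : K) • m := by
  induction r with
  | zero => simp
  | succ r ih =>
    rw [pow_succ t, Module.End.mul_apply, weyl_apply hy hty hm h0, map_smul, ih, smul_smul,
      Nat.factorial_succ]
    push_cast
    rfl

theorem factorial_cast_ne_zero {r : ℕ} (hr : r < p) : (r.factorial : K) ≠ 0 := by
  rw [Ne, CharP.cast_eq_zero_iff K p, (Fact.out : p.Prime).dvd_factorial]
  omega

theorem weyl_exists_of_apply_eq_zero
    (hy : ∀ m ∈ N, y m ∈ N) (hty : ∀ m ∈ N, t (y m) = y (t m) + m)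
    {m : M} (hm : m ∈ N) (h0 : t m = 0) :
    ∃ z ∈ N, (t ^ (p - 1)) z = m := by
  have hp : p - 1 < p := Nat.sub_lt (Fact.out : p.Prime).pos one_pos
  refine ⟨((p - 1).factorial : K)⁻¹ • (y ^ (p - 1)) m,
    N.smul_mem _ (weyl_mem_pow hy _ hm), ?_⟩
  rw [map_smul, weyl_pow_apply hy hty hm h0, inv_smul_smul₀ (factorial_cast_ne_zero hp)]

theorem weyl_exists_of_pow_apply_eq_zero
    (hy : ∀ m ∈ N, y m ∈ N) (hty : ∀ m ∈ N, t (y m) = y (t m) + m)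
    (ht : ∀ m ∈ N, t m ∈ N) {r : ℕ} (hr : r < p) {m : M}
    (hm : m ∈ N) (h0 : (t ^ r) m = 0) : ∃ z ∈ N, t z = m := by
  induction r generalizing m with
  | zero => exact ⟨0, N.zero_mem, by simpa using h0.symm⟩
  | succ r ih =>
    set w := (t ^ r) m with hw
    have hwN : w ∈ N := weyl_mem_pow ht _ hm
    have htw : t w = 0 := by rw [hw, ← Module.End.mul_apply, ← pow_succ', h0]
    have hr0 : (r.factorial : K) ≠ 0 := factorial_cast_ne_zero (p := p) (by omega)
    have hr1 : ((r + 1).factorial : K) ≠ 0 := factorial_cast_ne_zero hr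
    obtain ⟨z, hz, htz⟩ := ih (by omega)
      (N.sub_mem hm (N.smul_mem (r.factorial : K)⁻¹ (weyl_mem_pow hy r hwN)))
      (by rw [map_sub, map_smul, weyl_pow_apply hy hty hwN htw, inv_smul_smul₀ hr0, sub_self])
    refine ⟨z + ((r + 1).factorial : K)⁻¹ • (y ^ (r + 1)) w,
      N.add_mem hz (N.smul_mem _ (weyl_mem_pow hy _ hwN)), ?_⟩
    rw [map_add, map_smul, htz, weyl_apply hy hty hwN htw, smul_smul]
    have : ((r + 1).factorial : K)⁻¹ * ((r : K) + 1) = (r.factorial : K)⁻¹ := by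
      rw [Nat.factorial_succ] at hr1 ⊢
      push_cast at hr1 ⊢
      have := left_ne_zero_of_mul hr1
      field_simp
    rw [this, sub_add_cancel]

end Weyl

section Orbits

/-- For an action of an elementary abelian group there is a function which is affine along the
orbits and nonconstant on every orbit with more than one point. -/
theorem exists_affine_on_orbits (p : ℕ) [Fact p.Prime] {G S : Type*} [AddCommGroup G]
    [Module (ZMod p) G] (act : G → S → S) (act_zero : ∀ s, act 0 s = s)
    (act_add : ∀ a b s, act (a + b) s = act a (act b s)) :
    ∃ (χ : S → G →ₗ[ZMod p] ZMod p) (h : S → ZMod p),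
      (∀ a s, χ (act a s) = χ s) ∧ (∀ a s, h (act a s) = h s + χ s a) ∧
      ∀ s, (∃ a, act a s ≠ s) → χ s ≠ 0 := by
  classical
  let R : Setoid S :=
    { r := fun s s' => ∃ a, act a s = s'
      iseqv := ⟨fun s => ⟨0, act_zero s⟩,
        by
          rintro s _ ⟨a, rfl⟩
          exact ⟨-a, by rw [← act_add, neg_add_cancel, act_zero]⟩,
        by
          rintro s _ _ ⟨a, rfl⟩ ⟨b, rfl⟩
          exact ⟨b + a, act_add _ _ _⟩⟩ }
  let rep : S → S := fun s => (Quotient.mk R s).out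
  have hrep : ∀ s, ∃ a, act a (rep s) = s := fun s =>
    @Quotient.exact S R _ _ (Quotient.out_eq (Quotient.mk R s))
  have hrep_act : ∀ a s, rep (act a s) = rep s := fun a s => by
    have : Quotient.mk R (act a s) = Quotient.mk R s := 
      (@Quotient.sound S R _ _ ⟨a, rfl⟩).symm
    simp only [rep, this]
  choose d hd using hrep
  let stab : S → AddSubgroup G := fun s =>
    { carrier := {a | act a s = s}
      zero_mem' := act_zero s
      add_mem' := fun {a b} ha hb => by
        rw [Set.mem_ofPred_eq] at *
        rw [act_add, hb, ha]
      neg_mem' := fun {a} ha => by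
        rw [Set.mem_ofPred_eq] at *
        nth_rewrite 1 [← ha]
        rw [← act_add, neg_add_cancel, act_zero] }
  have hf : ∀ s, ∃ f : G →ₗ[ZMod p] ZMod p, (∀ a, act a s = s → f a = 0) ∧
      ((∃ a, act a s ≠ s) → f ≠ 0) := fun s => by
    by_cases hs : ∃ a, act a s ≠ s
    · obtain ⟨a, ha⟩ := hs
      have : AddSubgroup.toZModSubmodule p (stab s) < ⊤ := by
        rw [lt_top_iff_ne_top]
        intro h
        exact ha (h.symm ▸ Submodule.mem_top : a ∈ AddSubgroup.toZModSubmodule p (stab s))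
      obtain ⟨f, hf, hle⟩ := Submodule.exists_le_ker_of_lt_top _ this
      exact ⟨f, fun b hb => hle (show b ∈ AddSubgroup.toZModSubmodule p (stab s) from hb),
        fun _ => hf⟩
    · exact ⟨0, fun _ _ => rfl, fun h => (hs h).elim⟩
  choose f hf hf0 using hf
  refine ⟨fun s => f (rep s), fun s => f (rep s) (d s),
    fun a s => by beta_reduce; rw [hrep_act], fun a s => ?_,
    fun s hs => hf0 _ ?_⟩
  · have : f (rep s) (d (act a s) - (a + d s)) = 0 := hf _ _ (by
      have h1 := hd (act a s)
      rw [hrep_act] at h1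
      have : d (act a s) - (a + d s) = -(a + d s) + d (act a s) := by abel
      have h2 : act (a + d s) (rep s) = act a s := by rw [act_add, hd]
      rw [this, act_add, h1, ← h2, ← act_add, neg_add_cancel, act_zero])
    beta_reduce
    rw [hrep_act, ← map_add, add_comm (d s), ← sub_eq_zero, ← map_sub, this]
  · obtain ⟨a, ha⟩ := hs
    by_contra! hc
    have : rep s = s := (hc (d s)).symm.trans (hd s)
    rw [this] at hc
    exact ha (hc a)

end Orbits

section CharP

variable {p : ℕ} [Fact p.Prime]

theorem sum_pow_char_of_commute {A J : Type*} [Ring A] [CharP A p] (s : Finset J) (f : J → A)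
    (h : ∀ i j, Commute (f i) (f j)) : (∑ i ∈ s, f i) ^ p = ∑ i ∈ s, f i ^ p := by
  classical
  induction s using Finset.induction_on with
  | empty => simp [(Fact.out : p.Prime).ne_zero]
  | insert a s ha ih =>
    rw [Finset.sum_insert ha, Finset.sum_insert ha,
      add_pow_char_of_commute _ (Commute.sum_right _ _ _ fun i _ => h a i), ih]

theorem shift_pow_char {p : ℕ} {K A : Type*} [Field K] [CharP K p] [Ring A] {ρ : K → A}
    (h0 : ρ 0 = 1) (hadd : ∀ a b, ρ (a + b) = ρ a * ρ b) (a : K) : ρ a ^ p = 1 := by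
  have : ∀ n : ℕ, ρ a ^ n = ρ (n * a) := fun n => by
    induction n with
    | zero => simp [h0]
    | succ n ih =>
      rw [pow_succ, ih, ← hadd]
      congr 1
      push_cast
      ring
  rw [this, CharP.cast_eq_zero, zero_mul, h0]

theorem shift_commute {K A : Type*} [Field K] [Ring A] {ρ : K → A}
    (hadd : ∀ a b, ρ (a + b) = ρ a * ρ b) (a b : K) : Commute (ρ a) (ρ b) := by
  rw [Commute, SemiconjBy, ← hadd, ← hadd, add_comm]

variable {K A J : Type*} [Field K] [CharP K p] [Ring A] [Algebra K A] [Fintype J]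

/-- The nilpotent element `∑ eᵢ (ρ(eᵢ) - 1)` attached to a representation `ρ` of `(K, +)`. -/
noncomputable def shiftSum (e : J → K) (ρ : K → A) : A := ∑ i, e i • (ρ (e i) - 1)

theorem shiftSum_pow_char [Nontrivial A] {ρ : K → A} (h0 : ρ 0 = 1)
    (hadd : ∀ a b, ρ (a + b) = ρ a * ρ b) (e : J → K) : shiftSum e ρ ^ p = 0 := by
  have : CharP A p := charP_of_injective_algebraMap (algebraMap K A).injective p
  have hc : ∀ i j, Commute (e i • (ρ (e i) - 1)) (e j • (ρ (e j) - 1)) := fun i j =>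
    ((((shift_commute hadd _ _).sub_left (Commute.one_left _)).sub_right
      (Commute.one_right _)).smul_left _).smul_right _
  rw [shiftSum, sum_pow_char_of_commute _ _ hc]
  refine Finset.sum_eq_zero fun i _ => ?_
  rw [smul_pow, sub_pow_char_of_commute _ (Commute.one_right _), shift_pow_char h0 hadd, one_pow,
    sub_self, smul_zero]

end CharP

section Shift

variable {p : ℕ} [Fact p.Prime] {K ι J : Type*} [Field K] [CharP K p] [Fintype J]

/-- Translate the second component of a pair. -/
def sh (a : K) (v : ι × K) : ι × K := (v.1, a + v.2)

theorem sh_zero : sh (0 : K) = (id : ι × K → ι × K) := by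
  funext v
  simp [sh]

theorem sh_add (a b : K) : sh (a + b) = (sh a ∘ sh b : ι × K → ι × K) := by
  funext v
  simp [sh, add_assoc]

theorem sh_injective (a : K) : Function.Injective (sh a : ι × K → ι × K) := fun v w h => by
  simp only [sh, Prod.mk.injEq, add_right_inj] at h
  exact Prod.ext h.1 h.2

/-- Translation of functions on lists. -/
noncomputable def shFun (a : K) : (List (ι × K) → K) →ₗ[K] (List (ι × K) → K) :=
  LinearMap.funLeft K K (List.map (sh a))

theorem shFun_apply (a : K) (f : List (ι × K) → K) (l : List (ι × K)) :
    shFun a f l = f (l.map (sh a)) := rfl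

theorem shFun_zero : shFun (0 : K) = (1 : Module.End K (List (ι × K) → K)) := by
  ext f l
  simp [shFun_apply, sh_zero]

theorem shFun_add (a b : K) :
    (shFun (a + b) : Module.End K (List (ι × K) → K)) = shFun a * shFun b := by
  ext f l
  simp [shFun_apply, add_comm a b, sh_add]

theorem shFun_mul (a : K) (f g : List (ι × K) → K) :
    shFun a (f * g) = shFun a f * shFun a g := rfl

theorem map_sh_zero : (map (sh (0 : K)) : Module.End K (ListChain K (ι × K))) = 1 :=
  hom_ext fun l => by simp [sh_zero]

theorem map_sh_add (a b : K) :
    (map (sh (a + b)) : Module.End K (ListChain K (ι × K))) = map (sh a) * map (sh b) :=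
  hom_ext fun l => by simp [sh_add]

/-- The nilpotent operator on functions on lists. -/
noncomputable def shT (e : J → K) : Module.End K (List (ι × K) → K) := shiftSum e shFun

/-- The nilpotent operator on chains. -/
noncomputable def mapT (e : J → K) : Module.End K (ListChain K (ι × K)) :=
  shiftSum e fun a => map (sh a)

theorem mapT_pow_char (e : J → K) : (mapT e : Module.End K (ListChain K (ι × K))) ^ p = 0 :=
  shiftSum_pow_char map_sh_zero map_sh_add e

theorem shT_apply (e : J → K) (f : List (ι × K) → K) :
    shT e f = ∑ i, e i • (shFun (e i) f - f) := by
  simp [shT, shiftSum, LinearMap.sum_apply]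

theorem mapT_apply (e : J → K) (c : ListChain K (ι × K)) :
    mapT e c = ∑ i, e i • (map (sh (e i)) c - c) := by
  simp [mapT, shiftSum, LinearMap.sum_apply]

theorem shT_pairing (e : J → K) (f : List (ι × K) → K) (c : ListChain K (ι × K)) :
    Finsupp.linearCombination K (shT e f) c = Finsupp.linearCombination K f (mapT e c) := by
  have : Finsupp.linearCombination K (shT e f) = Finsupp.linearCombination K f ∘ₗ mapT e :=
    hom_ext fun l => by simp [mapT_apply, shT_apply, shFun_apply]
  exact LinearMap.congr_fun this c

theorem shT_pow_pairing (e : J → K) (r : ℕ) (f : List (ι × K) → K) (c : ListChain K (ι × K)) :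
    Finsupp.linearCombination K ((shT e ^ r) f) c =
      Finsupp.linearCombination K f ((mapT e ^ r) c) := by
  induction r generalizing c with
  | zero => simp
  | succ r ih => rw [pow_succ', pow_succ, Module.End.mul_apply, shT_pairing, ih]; rfl

/-- A list is good if it misses an element of every fibre. -/
def Good {K ι : Type*} (l : List (ι × K)) : Prop := ∀ i, ∃ c, (i, c) ∉ l

theorem Good.map_sh {l : List (ι × K)} (hl : Good l) (a : K) : Good (l.map (sh a)) := fun i => by
  obtain ⟨c, hc⟩ := hl i
  refine ⟨a + c, fun h => hc ?_⟩
  obtain ⟨⟨i', c'⟩, hv, h⟩ := List.mem_map.1 h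
  simp only [sh, Prod.mk.injEq, add_right_inj] at h
  rwa [← h.1, ← h.2]

theorem Good.of_subset {K ι : Type*} {l l' : List (ι × K)} (hl : Good l) (h : l' ⊆ l) :
    Good l' := fun i =>
  (hl i).imp fun _ hc hm => hc (h hm)

theorem good_map_sh_iff {l : List (ι × K)} (a : K) : Good (l.map (sh a)) ↔ Good l := by
  refine ⟨fun h => ?_, fun h => h.map_sh a⟩
  have := h.map_sh (-a)
  rwa [List.map_map, ← sh_add, neg_add_cancel, sh_zero, List.map_id] at this

/-- Alternating functions supported on nonempty good lists. -/
def goodAlt (K ι : Type*) [Field K] : Submodule K (List (ι × K) → K) where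
  carrier := {f | IsAlt f ∧ ∀ l, ¬ (Good l ∧ l ≠ []) → f l = 0}
  zero_mem' := ⟨⟨by simp, by simp⟩, by simp⟩
  add_mem' := by
    rintro f g ⟨hf, hf0⟩ ⟨hg, hg0⟩
    refine ⟨⟨fun l₁ a b l₂ => ?_, fun l₁ a l₂ => ?_⟩, fun l hl => ?_⟩
    · simp only [Pi.add_apply, hf.swap l₁ a b, hg.swap l₁ a b]
      ring
    · simp only [Pi.add_apply, hf.dup l₁ a, hg.dup l₁ a, add_zero]
    · simp only [Pi.add_apply, hf0 l hl, hg0 l hl, add_zero]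
  smul_mem' := by
    rintro r f ⟨hf, hf0⟩
    refine ⟨⟨fun l₁ a b l₂ => ?_, fun l₁ a l₂ => ?_⟩, fun l hl => ?_⟩
    · simp only [Pi.smul_apply, hf.swap l₁ a b, smul_neg]
    · simp only [Pi.smul_apply, hf.dup l₁ a, smul_zero]
    · simp only [Pi.smul_apply, hf0 l hl, smul_zero]

theorem shFun_mem {f : List (ι × K) → K} (hf : f ∈ goodAlt K ι) (a : K) :
    shFun a f ∈ goodAlt K ι :=
  ⟨isAlt_map hf.1 _, fun l hl => hf.2 _ fun h =>
    hl ⟨(good_map_sh_iff a).1 h.1, by simpa using h.2⟩⟩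

theorem shT_mem (e : J → K) {f : List (ι × K) → K} (hf : f ∈ goodAlt K ι) :
    shT e f ∈ goodAlt K ι := by
  rw [shT_apply]
  exact Submodule.sum_mem _ fun i _ =>
    Submodule.smul_mem _ _ (Submodule.sub_mem _ (shFun_mem hf _) hf)

theorem mul_toFinset_mem [DecidableEq (ι × K)] {f : List (ι × K) → K} (hf : f ∈ goodAlt K ι)
    (d : Finset (ι × K) → K) : (fun l => d l.toFinset) * f ∈ goodAlt K ι :=
  ⟨hf.1.mul_toFinset d, fun l hl => by simp [hf.2 l hl]⟩

theorem exists_weyl_partner [Algebra (ZMod p) K] (e : Module.Basis J (ZMod p) K) :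
    ∃ y : Module.End K (List (ι × K) → K), (∀ m ∈ goodAlt K ι, y m ∈ goodAlt K ι) ∧
      ∀ m ∈ goodAlt K ι, shT e (y m) = y (shT e m) + m := by
  classical
  obtain ⟨χ, h, hχ, hh, hχ0⟩ := exists_affine_on_orbits p
    (fun (a : K) (s : Finset (ι × K)) => s.image (sh a)) (fun s => by simp [sh_zero])
    (fun a b s => by simp [sh_add, Finset.image_image])
  have hmap : ∀ (l : List (ι × K)) (a : K), (l.map (sh a)).toFinset = l.toFinset.image (sh a) :=
    fun l a => by ext; simp
  -- the diagonal operators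
  let H : List (ι × K) → K := fun l => algebraMap (ZMod p) K (h l.toFinset)
  let c : J → List (ι × K) → K := fun i l => algebraMap (ZMod p) K (χ l.toFinset (e i))
  let D' : Finset (ι × K) → K := fun s => ∑ i, e i * algebraMap (ZMod p) K (χ s (e i))
  let D : List (ι × K) → K := fun l => D' l.toFinset
  let E : List (ι × K) → K := fun l => ((D' l.toFinset)⁻¹) ^ p
  have hcs : ∀ i a, shFun a (c i) = c i := fun i a => by
    funext l
    simp only [shFun_apply, c, hmap, hχ]
  have hEs : ∀ a, shFun a E = E := fun a => by
    funext l
    simp only [shFun_apply, E, D', hmap, hχ]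
  have hHs : ∀ i, shFun (e i) H = H + c i := fun i => by
    funext l
    simp only [shFun_apply, H, hmap, hh, map_add, Pi.add_apply, c]
  have hD0 : ∀ l : List (ι × K), Good l → l ≠ [] → D l ≠ 0 := by
    intro l hl hne h0
    refine hχ0 l.toFinset ?_ (e.ext fun i => ?_)
    · obtain ⟨⟨i, b⟩, hb⟩ := List.exists_mem_of_ne_nil l hne
      obtain ⟨b', hb'⟩ := hl i
      refine ⟨b' - b, fun heq => hb' ?_⟩
      rw [← List.mem_toFinset, ← heq]
      exact Finset.mem_image.2 ⟨(i, b), by simpa using hb, by simp [sh]⟩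
    · refine Fintype.linearIndependent_iff.1 e.linearIndependent (fun i => χ l.toFinset (e i)) ?_ i
      rw [← h0]
      exact Finset.sum_congr rfl fun i _ => by rw [Algebra.smul_def, mul_comm]
  let mH : Module.End K (List (ι × K) → K) := LinearMap.mulLeft K H
  let mE : Module.End K (List (ι × K) → K) := LinearMap.mulLeft K E
  let g : J → Module.End K (List (ι × K) → K) := fun i =>
    LinearMap.mulLeft K (e i • c i) * shFun (e i)
  let u : Module.End K (List (ι × K) → K) := ∑ i, g i
  have hg : ∀ i f, g i f = e i • (c i * shFun (e i) f) := fun i f => by simp [g]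
  have hgsh : ∀ i a, Commute (g i) (shFun a) := fun i a => by
    refine LinearMap.ext fun f => ?_
    change g i (shFun a f) = shFun a (g i f)
    rw [hg, hg, map_smul, shFun_mul, hcs,
      ← Module.End.mul_apply, ← Module.End.mul_apply, ← shFun_add, ← shFun_add, add_comm]
  have hgc : ∀ i j, Commute (g i) (LinearMap.mulLeft K (e j • c j)) := fun i j => by
    refine LinearMap.ext fun f => ?_
    simp only [Module.End.mul_apply, hg, LinearMap.mulLeft_apply, shFun_mul, map_smul, hcs]
    simp only [smul_mul_assoc, mul_smul_comm]
    rw [mul_left_comm]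
  have hgg : ∀ i j, Commute (g i) (g j) := fun i j => (hgc i j).mul_right (hgsh i (e j))
  have hu : u ^ p = LinearMap.mulLeft K (D ^ p) := by
    have : CharP (Module.End K (List (ι × K) → K)) p :=
      charP_of_injective_algebraMap (algebraMap K _).injective p
    have : CharP (List (ι × K) → K) p :=
      charP_of_injective_algebraMap (algebraMap K _).injective p
    have hterm : ∀ i, g i ^ p = LinearMap.mulLeft K ((e i • c i) ^ p) := fun i => by
      have : Commute (LinearMap.mulLeft K (e i • c i)) (shFun (e i)) := by
        refine LinearMap.ext fun f => ?_
        simp only [Module.End.mul_apply, LinearMap.mulLeft_apply, shFun_mul, map_smul, hcs]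
      rw [this.mul_pow, shift_pow_char (ρ := shFun) shFun_zero shFun_add, mul_one,
        LinearMap.pow_mulLeft]
    have hDsum : D = ∑ i, e i • c i := by
      funext l
      simp [D, D', c]
    rw [sum_pow_char_of_commute _ _ hgg, hDsum, sum_pow_char_of_commute _ _ fun i j => .all _ _]
    simp only [hterm]
    refine LinearMap.ext fun f => ?_
    simp [LinearMap.sum_apply, Finset.sum_mul]
  have hut : Commute u (shT e) := by
    refine Commute.sum_left _ _ _ fun i _ => ?_
    rw [shT, shiftSum]
    exact Commute.sum_right _ _ _ fun j _ =>
      ((hgsh i (e j)).sub_right (Commute.one_right _)).smul_right _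
  have htH : ∀ f, shT e (mH f) = mH (shT e f) + u f := fun f => by
    simp only [u, LinearMap.sum_apply, hg, shT_apply, mH, LinearMap.mulLeft_apply, shFun_mul, hHs,
      Finset.mul_sum]
    rw [← Finset.sum_add_distrib]
    refine Finset.sum_congr rfl fun i _ => ?_
    rw [mul_smul_comm, ← smul_add]
    congr 1
    ring
  have htE : Commute (shT e) mE := by
    refine LinearMap.ext fun f => ?_
    change shT e (E * f) = E * shT e f
    simp only [shT_apply, shFun_mul, hEs, Finset.mul_sum, mul_smul_comm, mul_sub]
  have hmH : ∀ m ∈ goodAlt K ι, mH m ∈ goodAlt K ι := fun m hm =>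
    mul_toFinset_mem hm fun s => algebraMap (ZMod p) K (h s)
  have hmE : ∀ m ∈ goodAlt K ι, mE m ∈ goodAlt K ι := fun m hm =>
    mul_toFinset_mem hm fun s => ((D' s)⁻¹) ^ p
  have hmu : ∀ m ∈ goodAlt K ι, u m ∈ goodAlt K ι := fun m hm => by
    simp only [u, LinearMap.sum_apply, hg]
    exact Submodule.sum_mem _ fun i _ => Submodule.smul_mem _ _
      (mul_toFinset_mem (shFun_mem hm _) fun s => algebraMap (ZMod p) K (χ s (e i)))
  refine ⟨mE * u ^ (p - 1) * mH, fun m hm => hmE _ (weyl_mem_pow hmu _ (hmH m hm)), fun m hm => ?_⟩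
  have hcomm : Commute (shT e) (mE * u ^ (p - 1)) := htE.mul_right (hut.symm.pow_right _)
  have h1 : shT e ((mE * u ^ (p - 1) * mH) m) = (mE * u ^ (p - 1)) (shT e (mH m)) := by
    rw [Module.End.mul_apply (mE * u ^ (p - 1)), ← Module.End.mul_apply, hcomm.eq]
    rfl
  have h2 : (mE * u ^ (p - 1)) (u m) = m := by
    have : (mE * u ^ (p - 1)) (u m) = mE ((u ^ p) m) := by
      conv_rhs => rw [← Nat.sub_add_cancel (Fact.out : p.Prime).one_le, pow_succ]
      rfl
    rw [this, hu]
    funext l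
    by_cases hl : Good l ∧ l ≠ []
    · have := hD0 l hl.1 hl.2
      simp only [mE, E, LinearMap.mulLeft_apply, Pi.mul_apply, Pi.pow_apply]
      change D l ≠ 0 at this
      change (D l)⁻¹ ^ p * (D l ^ p * m l) = m l
      rw [← mul_assoc, ← mul_pow, inv_mul_cancel₀ this, one_pow, one_mul]
    · simp [mE, hm.2 l hl]
  rw [h1, htH, map_add, h2]
  rfl

end Shift

section Obstruction

variable {p : ℕ} [Fact p.Prime] {K ι J : Type*} [Field K] [CharP K p] [Fintype J]

open scoped Classical in
/-- The coboundary, truncated to nonempty good lists. -/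
noncomputable def goodCoboundary (K ι : Type*) [Field K] : Module.End K (List (ι × K) → K) where
  toFun f l := if Good l ∧ l ≠ [] then coboundary f l else 0
  map_add' f g := by
    funext l
    by_cases h : Good l ∧ l ≠ [] <;>
      simp [h, coboundary, Finsupp.linearCombination_apply, Finsupp.sum, mul_add,
        Finset.sum_add_distrib]
  map_smul' r f := by
    funext l
    by_cases h : Good l ∧ l ≠ [] <;>
      simp [h, coboundary, Finsupp.linearCombination_apply, Finsupp.sum, Finset.mul_sum,
        mul_left_comm]

theorem goodCoboundary_of_good {f : List (ι × K) → K} {l : List (ι × K)} (hl : Good l)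
    (hne : l ≠ []) : goodCoboundary K ι f l = coboundary f l := by
  simp [goodCoboundary, hl, hne]

theorem goodCoboundary_of_not {f : List (ι × K) → K} {l : List (ι × K)}
    (hl : ¬ (Good l ∧ l ≠ [])) : goodCoboundary K ι f l = 0 := if_neg hl

theorem goodCoboundary_mem {f : List (ι × K) → K} (hf : IsAlt f) :
    goodCoboundary K ι f ∈ goodAlt K ι := by
  classical
  refine ⟨?_, fun l hl => goodCoboundary_of_not hl⟩
  let d : Finset (ι × K) → K := fun s => if (∀ i, ∃ c, (i, c) ∉ s) ∧ s ≠ ∅ then 1 else 0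
  have : goodCoboundary K ι f = fun l => d l.toFinset * coboundary f l := by
    funext l
    have hd : d l.toFinset = if Good l ∧ l ≠ [] then 1 else 0 := by
      simp only [d, Good, List.mem_toFinset, ne_eq, List.toFinset_eq_empty_iff]
      congr
    rw [hd]
    by_cases hl : Good l ∧ l ≠ []
    · rw [goodCoboundary_of_good hl.1 hl.2, if_pos hl, one_mul]
    · rw [goodCoboundary_of_not hl, if_neg hl, zero_mul]
  rw [this]
  exact hf.coboundary.mul_toFinset d

theorem coboundary_goodCoboundary (f : List (ι × K) → K) {l : List (ι × K)} (hl : Good l) :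
    coboundary (goodCoboundary K ι f) l = 0 := by
  have h : coboundary (goodCoboundary K ι f) l = coboundary (coboundary f) l := by
    refine eq_of_supported _ _ (fun l' hl' => ?_) (bdList_mem l)
    by_cases hne : l' = []
    · subst hne
      simp [goodCoboundary_of_not, coboundary, bdList]
    · simp [goodCoboundary_of_good (hl.of_subset hl'.1.subset) hne]
  rw [h, coboundary_coboundary]
  rfl

theorem goodCoboundary_commute_shT (e : J → K) :
    Commute (goodCoboundary K ι) (shT e) := by
  have h : ∀ a : K, Commute (goodCoboundary K ι) (shFun a) := fun a => by
    refine LinearMap.ext fun f => ?_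
    funext l
    change goodCoboundary K ι (shFun a f) l = goodCoboundary K ι f (l.map (sh a))
    by_cases hl : Good l ∧ l ≠ []
    · rw [goodCoboundary_of_good hl.1 hl.2,
        goodCoboundary_of_good (hl.1.map_sh a) (by simpa using hl.2), coboundary_map]
      rfl
    · rw [goodCoboundary_of_not hl, goodCoboundary_of_not (by
        rwa [good_map_sh_iff, ne_eq, List.map_eq_nil_iff])]
  exact Commute.sum_right _ _ _ fun i _ => ((h _).sub_right (Commute.one_right _)).smul_right _

theorem goodCoboundary_pairing (f : List (ι × K) → K) {c : ListChain K (ι × K)}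
    (hc : c ∈ Finsupp.supported K K {l | Good l ∧ l ≠ []}) :
    Finsupp.linearCombination K (goodCoboundary K ι f) c =
      Finsupp.linearCombination K f (bd c) := by
  rw [← coboundary_pairing]
  exact eq_of_supported _ _ (fun l hl => by simp [goodCoboundary_of_good hl.1 hl.2]) hc

theorem exists_pow_eq_of_pow_eq_zero [Algebra (ZMod p) K] (e : Module.Basis J (ZMod p) K)
    {a b : ℕ} (hab : a = 1 ∧ b = p - 1 ∨ a = p - 1 ∧ b = 1) {d : List (ι × K) → K}
    (hd : d ∈ goodAlt K ι) (h0 : (shT e ^ b) d = 0) :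
    ∃ f ∈ goodAlt K ι, (shT e ^ a) f = d := by
  obtain ⟨y, hy, hty⟩ := exists_weyl_partner (ι := ι) e
  rcases hab with ⟨rfl, rfl⟩ | ⟨rfl, rfl⟩
  · simpa using weyl_exists_of_pow_apply_eq_zero (p := p) hy hty (fun m hm => shT_mem e hm)
      (Nat.sub_lt (Fact.out : p.Prime).pos one_pos) hd h0
  · exact weyl_exists_of_apply_eq_zero (p := p) hy hty hd (by simpa using h0)

theorem goodAlt_pairing_eq_zero [Fintype ι] [Fintype K] {d : List (ι × K) → K}
    (hd : d ∈ goodAlt K ι) {c : ListChain K (ι × K)} {r : ℕ}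
    (hr : Fintype.card ι * (Fintype.card K - 1) < r)
    (hc : c ∈ Finsupp.supported K K {l | Good l ∧ l.length = r}) :
    Finsupp.linearCombination K d c = 0 := by
  classical
  refine eq_zero_of_supported _ (fun l hl => ?_) hc
  rw [Finsupp.linearCombination_single, one_smul]
  refine hd.1.eq_zero_of_not_nodup fun hn => ?_
  choose g hg using hl.1
  have h1 : l.toFinset ⊆ Finset.univ \ Finset.univ.image fun i => (i, g i) := fun x hx => by
    simp only [Finset.mem_sdiff, Finset.mem_univ, Finset.mem_image, true_and, not_exists]
    rintro i rfl
    exact hg i (List.mem_toFinset.1 hx)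
  have h2 := Finset.card_le_card h1
  rw [List.toFinset_card_of_nodup hn, hl.2, Finset.card_sdiff_of_subset (Finset.subset_univ _),
    Finset.card_image_of_injective _ fun i j h => (Prod.mk.inj h).1, Finset.card_univ,
    Finset.card_univ, Fintype.card_prod] at h2
  rw [Nat.mul_sub_one] at hr
  omega

theorem no_equivariant_good_map [Fintype ι] [Nonempty ι] [Fintype K] [Algebra (ZMod p) K]
    (L : ListChain K (ι × K) →ₗ[K] ListChain K (ι × K))
    (h_nil : L (Finsupp.single [] 1) = Finsupp.single [] 1)
    (h_bd : ∀ w : List (ι × K), w.Nodup → bd (L (Finsupp.single w 1)) = L (bdList K w))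
    (h_sh : ∀ (a : K) (w : List (ι × K)), w.Nodup →
      L (Finsupp.single (w.map (sh a)) 1) = map (sh a) (L (Finsupp.single w 1)))
    (h_good : ∀ w : List (ι × K), w.Nodup →
      L (Finsupp.single w 1) ∈ Finsupp.supported K K {l | Good l ∧ l.length = w.length}) :
    False := by
  classical
  have e := Module.finBasis (ZMod p) K
  have hp := (Fact.out : p.Prime)
  have L_bd : ∀ {r} {c : ListChain K (ι × K)}, c ∈ words K Finset.univ r →
      bd (L c) = L (bd c) := fun hc => by
    rw [← LinearMap.comp_apply, ← LinearMap.comp_apply]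
    exact eq_of_supported _ _ (fun l hl => by simpa using h_bd l hl.1) hc
  have L_good : ∀ {r} {c : ListChain K (ι × K)}, c ∈ words K Finset.univ r →
      L c ∈ Finsupp.supported K K {l | Good l ∧ l.length = r} := fun hc =>
    map_mem_of_supported _ (fun l hl => by simpa [hl.2.2] using h_good l hl.1) hc
  have map_mem : ∀ {r} {c : ListChain K (ι × K)} (a : K), c ∈ words K Finset.univ r →
      map (sh a) c ∈ words K Finset.univ r := fun a hc =>
    map_mem_of_supported _ (fun l hl => by
      rw [map_single]
      exact Finsupp.single_mem_supported K _
        ⟨hl.1.map (sh_injective a), by simp, by simpa using hl.2.2⟩) hc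
  have T_mem : ∀ {r} (a : ℕ) {c : ListChain K (ι × K)}, c ∈ words K Finset.univ r →
      (mapT e ^ a) c ∈ words K Finset.univ r := fun a _ hc =>
    weyl_mem_pow (N := words K Finset.univ _) (t := mapT e) (fun c hc => by
      rw [mapT_apply]
      exact Submodule.sum_mem _ fun i _ =>
        Submodule.smul_mem _ _ (Submodule.sub_mem _ (map_mem _ hc) hc)) a hc
  have L_T : ∀ {r} (a : ℕ) {c : ListChain K (ι × K)}, c ∈ words K Finset.univ r →
      L ((mapT e ^ a) c) = (mapT e ^ a) (L c) := fun {r} a c hc => by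
    have h1 : ∀ (b : K) {c}, c ∈ words K Finset.univ r → L (map (sh b) c) = map (sh b) (L c) :=
      fun b c hc => by
        rw [← LinearMap.comp_apply, ← LinearMap.comp_apply]
        exact eq_of_supported _ _ (fun l hl => by simpa using h_sh b l hl.1) hc
    induction a with
    | zero => simp
    | succ a ih =>
      rw [pow_succ', Module.End.mul_apply, Module.End.mul_apply, ← ih, mapT_apply, mapT_apply,
        map_sum]
      exact Finset.sum_congr rfl fun i _ => by rw [map_smul, map_sub, h1 _ (T_mem a hc)]
  have bd_T : ∀ (a : ℕ) (c : ListChain K (ι × K)), bd ((mapT e ^ a) c) = (mapT e ^ a) (bd c) :=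
    fun a c => by
      induction a with
      | zero => simp
      | succ a ih =>
        rw [pow_succ', Module.End.mul_apply, Module.End.mul_apply, ← ih, mapT_apply, mapT_apply,
          map_sum]
        exact Finset.sum_congr rfl fun i _ => by rw [map_smul, map_sub, map_bd]
  have key : ∀ r < Fintype.card (ι × K), ∃ a b,
      (a = 1 ∧ b = p - 1 ∨ a = p - 1 ∧ b = 1) ∧ ∃ z ∈ words K Finset.univ (r + 1),
      ∃ d ∈ goodAlt K ι, (mapT e ^ a) (bd z) = 0 ∧ (shT e ^ b) d = 0 ∧
      (∀ l, Good l → coboundary d l = 0) ∧ Finsupp.linearCombination K d (L z) = 1 := by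
    intro r
    induction r with
    | zero =>
      intro _
      let v : ι × K := (Classical.arbitrary ι, 0)
      let f : List (ι × K) → K := fun l => if l = [] then 1 else 0
      have hf : IsAlt f := ⟨by simp [f], by simp [f]⟩
      have hTf : shT e f = 0 := by
        have : ∀ a : K, shFun a f = f := fun a => by
          funext l
          simp [shFun_apply, f]
        simp [shT_apply, this]
      have hv : Finsupp.single [v] (1 : K) ∈ words K Finset.univ 1 :=
        Finsupp.single_mem_supported K _ ⟨by simp, by simp, rfl⟩
      have hbv : bd (Finsupp.single [v] (1 : K)) = Finsupp.single [] 1 := by simp [bdList]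
      have hT : mapT e (Finsupp.single ([] : List (ι × K)) (1 : K)) = 0 := by
        simp [mapT_apply]
      refine ⟨p - 1, 1, Or.inr ⟨rfl, rfl⟩, _, hv, goodCoboundary K ι f, goodCoboundary_mem hf, ?_,
        ?_, fun l hl => coboundary_goodCoboundary f hl, ?_⟩
      · obtain ⟨q, hq⟩ : ∃ q, p - 1 = q + 1 := ⟨p - 2, by have := hp.two_le; omega⟩
        rw [hbv, hq, pow_succ, Module.End.mul_apply, hT, map_zero]
      · rw [pow_one, ← Module.End.mul_apply, ← (goodCoboundary_commute_shT e).eq,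
          Module.End.mul_apply, hTf, map_zero]
      · rw [goodCoboundary_pairing _ (Finsupp.supported_mono ?_ (L_good hv)), L_bd hv, hbv, h_nil]
        · simp [f]
        rintro l ⟨hl, hlen⟩
        refine ⟨hl, ?_⟩
        rintro rfl
        simp at hlen
    | succ r ih =>
      intro hr
      obtain ⟨a, b, hab, z, hz, d, hd, hza, hdb, hδ, hL⟩ := ih (by omega)
      obtain ⟨f, hf, rfl⟩ := exists_pow_eq_of_pow_eq_zero e hab hd hdb
      obtain ⟨z', hz', hzz⟩ := exists_bd_eq_of_card _ Finset.univ rfl (r + 1)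
        (by rwa [Finset.card_univ]) _ (T_mem a hz) (by rw [bd_T, hza])
      have hsum : b + a = p := by
        have := hp.one_le
        omega
      refine ⟨b, a, by tauto, z', hz', goodCoboundary K ι f, goodCoboundary_mem hf.1, ?_, ?_,
        fun l hl => coboundary_goodCoboundary f hl, ?_⟩
      · rw [hzz, ← Module.End.mul_apply, ← pow_add, hsum, mapT_pow_char]
        rfl
      · rw [← Module.End.mul_apply, ← ((goodCoboundary_commute_shT e).pow_right a).eq,
          Module.End.mul_apply]
        funext l
        by_cases hl : Good l ∧ l ≠ []
        · rw [goodCoboundary_of_good hl.1 hl.2, hδ l hl.1]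
          rfl
        · exact goodCoboundary_of_not hl
      · rw [goodCoboundary_pairing _ (Finsupp.supported_mono ?_ (L_good hz')), L_bd hz', hzz,
          L_T a hz, ← shT_pow_pairing, hL]
        rintro l ⟨hl, hlen⟩
        refine ⟨hl, ?_⟩
        rintro rfl
        simp at hlen
  have hι : 0 < Fintype.card ι := Fintype.card_pos
  have hK : 1 < Fintype.card K := Fintype.one_lt_card
  obtain ⟨a, b, -, z, hz, d, hd, -, -, -, hL⟩ := key (Fintype.card ι * (Fintype.card K - 1)) (by
    rw [Fintype.card_prod]
    exact Nat.mul_lt_mul_of_pos_left (by omega) hι)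
  rw [goodAlt_pairing_eq_zero hd (Nat.lt_succ_self _) (L_good hz)] at hL
  exact zero_ne_one hL

end Obstruction

section Labels

variable {K ι : Type*} [Field K]

theorem map_map {X Y Z : Type*} (φ : Y → Z) (ψ : X → Y) (c : ListChain K X) :
    map φ (map ψ c) = map (φ ∘ ψ) c := by
  have : map φ ∘ₗ map ψ = (map (φ ∘ ψ) : ListChain K X →ₗ[K] _) := hom_ext fun l => by simp
  exact LinearMap.congr_fun this c

theorem map_congr_of_supported {X Y : Type*} {φ ψ : X → Y} {s : Set X} (h : ∀ x ∈ s, φ x = ψ x)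
    {t : Set (List X)} (ht : ∀ l ∈ t, ∀ x ∈ l, x ∈ s) {c : ListChain K X}
    (hc : c ∈ Finsupp.supported K K t) : map φ c = map ψ c :=
  eq_of_supported _ _ (fun l hl => by
    rw [map_single, map_single, List.map_congr_left fun x hx => h x (ht l hl x hx)]) hc

/-- The face of the standard simplex spanned by the letters of a word. -/
def face {B : Type*} [Fintype B] (w : List B) : Set (B → ℝ) :=
  stdSimplex ℝ B ∩ {τ | ∀ b, b ∉ w → τ b = 0}

theorem convex_face {B : Type*} [Fintype B] (w : List B) : Convex ℝ (face w) := by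
  refine (convex_stdSimplex ℝ B).inter ?_
  intro x hx y hy s t _ _ _ b hb
  simp [hx b hb, hy b hb]

theorem isCompact_face {B : Type*} [Fintype B] (w : List B) : IsCompact (face w) := by
  refine (isCompact_stdSimplex ℝ B).inter_right ?_
  simp only [Set.ofPred_forall]
  exact isClosed_iInter fun b => isClosed_iInter fun _ =>
    isClosed_eq (continuous_apply b) continuous_const

theorem single_mem_face {B : Type*} [Fintype B] [DecidableEq B] {w : List B} {b : B}
    (hb : b ∈ w) : (Pi.single b 1 : B → ℝ) ∈ face w :=
  ⟨single_mem_stdSimplex ℝ b, fun b' hb' => Pi.single_eq_of_ne (by rintro rfl; exact hb' hb) _⟩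

/-- The subword of letters with nonzero weight. -/
noncomputable def suppWord {B : Type*} (w : List B) (τ : B → ℝ) : List B :=
  w.filter fun b => τ b ≠ 0

theorem suppWord_eq_of_sublist {B : Type*} [Fintype B] {w w' : List B} (hw : w.Nodup)
    (h : w'.Sublist w) {τ : B → ℝ} (hτ : τ ∈ face w') : suppWord w τ = suppWord w' τ := by
  refine ((h.filter _).eq_of_length_le (List.Subperm.length_le ?_)).symm
  refine (hw.filter _).subperm fun b hb => ?_
  simp only [List.mem_filter, decide_eq_true_eq] at hb ⊢
  refine ⟨?_, hb.2⟩
  by_contra hc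
  exact hb.2 (hτ.2 b hc)

theorem suppWord_ne_nil {B : Type*} [Fintype B] {w : List B} {τ : B → ℝ} (hτ : τ ∈ face w) :
    suppWord w τ ≠ [] := by
  intro h
  have h0 : ∀ b, τ b = 0 := fun b => by
    by_contra hb
    have hbw : b ∈ w := by
      by_contra hc
      exact hb (hτ.2 b hc)
    have : b ∈ suppWord w τ := by simpa [suppWord] using ⟨hbw, hb⟩
    simp [h] at this
  have := hτ.1.2
  simp [h0] at this

theorem suppWord_map {B : Type*} (w : List B) (φ : B → B) (τ : B → ℝ) :
    suppWord (w.map φ) τ = (suppWord w (τ ∘ φ)).map φ := by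
  rw [suppWord, suppWord, List.filter_map]
  rfl

/-- The second component of the first letter of a word. -/
def headColor (w : List (ι × K)) : K := (w.head?.map Prod.snd).getD 0

theorem headColor_map_sh {w : List (ι × K)} (hw : w ≠ []) (a : K) :
    headColor (w.map (sh a)) = a + headColor w := by
  cases w with
  | nil => exact (hw rfl).elim
  | cons b w => simp [headColor, sh]

variable [Fintype K] [Fintype ι]

/-- The total variation of a finite family of reals. -/
def spread {K : Type*} [Fintype K] (f : K → ℝ) : ℝ := ∑ ℓ, ∑ ℓ', |f ℓ - f ℓ'|

theorem spread_comp_add (f : K → ℝ) (a : K) : spread (fun ℓ => f (a + ℓ)) = spread f := by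
  have h : ∀ g : K → ℝ, ∑ ℓ, g (a + ℓ) = ∑ ℓ, g ℓ := fun g => Equiv.sum_comp (Equiv.addLeft a) g
  rw [spread, h fun x => ∑ ℓ', |f x - f (a + ℓ')|]
  exact Finset.sum_congr rfl fun ℓ _ => h fun x => |f ℓ - f x|

theorem spread_eq_zero {K : Type*} [Fintype K] {f : K → ℝ} (hf : spread f ≤ 0) (ℓ ℓ' : K) :
    f ℓ = f ℓ' := by
  have h1 := Finset.single_le_sum (f := fun ℓ => ∑ ℓ', |f ℓ - f ℓ'|)
    (fun _ _ => Finset.sum_nonneg fun _ _ => abs_nonneg _) (Finset.mem_univ ℓ)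
  have h2 := Finset.single_le_sum (f := fun ℓ' => |f ℓ - f ℓ'|)
    (fun _ _ => abs_nonneg _) (Finset.mem_univ ℓ')
  exact sub_eq_zero.1 (abs_nonpos_iff.1 ((h2.trans h1).trans hf))

theorem spread_nonneg {K : Type*} [Fintype K] (f : K → ℝ) : 0 ≤ spread f :=
  Finset.sum_nonneg fun _ _ => Finset.sum_nonneg fun _ _ => abs_nonneg _

/-- An equivariant choice of a row of maximal spread, and of a maximal entry in that row. -/
theorem exists_label [Nonempty ι] : ∃ lab : K → (ι → K → ℝ) → ι × K,
    (∀ h (V : ι → K → ℝ) i, spread (V i) ≤ spread (V (lab h V).1)) ∧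
    (∀ h (V : ι → K → ℝ) ℓ, V (lab h V).1 ℓ ≤ V (lab h V).1 (lab h V).2) ∧
    ∀ a h (V V' : ι → K → ℝ), (∀ i ℓ, V' i (a + ℓ) = V i ℓ) →
      lab (a + h) V' = sh a (lab h V) := by
  have : ∀ V : ι → K → ℝ, ∃ x : ι × K, (∀ i, spread (V i) ≤ spread (V x.1)) ∧
      ∀ ℓ, V x.1 ℓ ≤ V x.1 x.2 := fun V => by
    obtain ⟨i, hi⟩ := Finite.exists_max fun i => spread (V i)
    obtain ⟨ℓ, hℓ⟩ := Finite.exists_max (V i)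
    exact ⟨(i, ℓ), hi, hℓ⟩
  choose lab₀ h₁ h₂ using this
  refine ⟨fun h V => sh h (lab₀ fun i ℓ => V i (h + ℓ)), fun h V i => ?_, fun h V ℓ => ?_,
    fun a h V V' hV => ?_⟩
  · have := h₁ (fun i ℓ => V i (h + ℓ)) i
    rwa [spread_comp_add, spread_comp_add] at this
  · have := h₂ (fun i ℓ => V i (h + ℓ)) (-h + ℓ)
    rwa [add_neg_cancel_left] at this
  · simp only [sh_add, Function.comp_apply, add_assoc, hV]

theorem exists_good_scale [Nonempty ι] {w : List (ι × K)} {V : (ι × K → ℝ) → ι → K → ℝ}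
    (hV : Continuous V) (hne : ∀ τ ∈ face w, ¬ ∀ i ℓ ℓ', V τ i ℓ = V τ i ℓ') :
    ∃ δ > 0, ∀ (lbl : (ι × K → ℝ) → ι × K),
      (∀ τ ∈ face w, (∀ i, spread (V τ i) ≤ spread (V τ (lbl τ).1)) ∧
        ∀ ℓ, V τ (lbl τ).1 ℓ ≤ V τ (lbl τ).1 (lbl τ).2) →
      ∀ l : List (ι × K → ℝ), (∀ τ ∈ l, τ ∈ face w) → (∀ τ ∈ l, ∀ τ' ∈ l, dist τ τ' < δ) →
        Good (l.map lbl) := by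
  have hpos : ∀ τ ∈ face w, 0 < ∑ i, spread (V τ i) := fun τ hτ => by
    refine (Finset.sum_nonneg fun i _ => spread_nonneg _).lt_of_ne fun h =>
      hne τ hτ fun i ℓ ℓ' => ?_
    refine spread_eq_zero ?_ ℓ ℓ'
    rw [h]
    exact Finset.single_le_sum (f := fun i => spread (V τ i)) (fun i _ => spread_nonneg _)
      (Finset.mem_univ i)
  obtain ⟨ε, hε, hmin⟩ : ∃ ε > 0, ∀ τ ∈ face w, ε ≤ ∑ i, spread (V τ i) := by
    have hcont : Continuous fun τ => ∑ i, spread (V τ i) := by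
      unfold spread
      fun_prop
    rcases (face w).eq_empty_or_nonempty with h | h
    · exact ⟨1, one_pos, by simp [h]⟩
    · obtain ⟨τ, hτ, hmin⟩ := (isCompact_face w).exists_isMinOn h hcont.continuousOn
      exact ⟨_, hpos τ hτ, fun τ' hτ' => hmin hτ'⟩
  set C : ℝ := Fintype.card ι * (Fintype.card K * Fintype.card K) with hC
  have hC0 : 0 < C := by positivity
  have hη : 0 < ε / (4 * C) := by positivity
  have huc := (isCompact_face w).uniformContinuousOn_of_continuous hV.continuousOn
  obtain ⟨δ, hδ, hclose⟩ := Metric.uniformContinuousOn_iff.1 huc _ hη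
  refine ⟨δ, hδ, fun lbl hlbl l hl hdist i => ?_⟩
  by_contra! hfull
  have hpt : ∀ c, ∃ τ ∈ l, lbl τ = (i, c) := fun c => List.mem_map.1 (hfull c)
  choose τ hτ hτc using hpt
  have hval : ∀ c c', V (τ 0) i c' - V (τ 0) i c ≤ 2 * (ε / (4 * C)) := fun c c' => by
    have h1 := (hlbl _ (hl _ (hτ c))).2 c'
    rw [hτc] at h1
    have h2 : ∀ c', |V (τ 0) i c' - V (τ c) i c'| < ε / (4 * C) := fun c' => by
      have := hclose _ (hl _ (hτ 0)) _ (hl _ (hτ c)) (hdist _ (hτ 0) _ (hτ c))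
      rw [← Real.dist_eq]
      exact (dist_le_pi_dist (V (τ 0) i) (V (τ c) i) c').trans
        (dist_le_pi_dist (V (τ 0)) (V (τ c)) i) |>.trans_lt this
    have h3 := abs_lt.1 (h2 c)
    have h4 := abs_lt.1 (h2 c')
    dsimp only at h1
    linarith [h3.1, h4.2]
  have hs : spread (V (τ 0) i) ≤ Fintype.card K * (Fintype.card K * (2 * (ε / (4 * C)))) := by
    have : spread (V (τ 0) i) ≤ ∑ _ℓ : K, ∑ _ℓ' : K, 2 * (ε / (4 * C)) :=
      Finset.sum_le_sum fun ℓ _ => Finset.sum_le_sum fun ℓ' _ => abs_sub_le_iff.2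
        ⟨hval ℓ' ℓ, hval ℓ ℓ'⟩
    simpa using this
  have htot : ∑ i', spread (V (τ 0) i') ≤ Fintype.card ι * spread (V (τ 0) i) := by
    have : ∑ i', spread (V (τ 0) i') ≤ ∑ _i' : ι, spread (V (τ 0) i) :=
      Finset.sum_le_sum fun i' _ => by
        have := (hlbl _ (hl _ (hτ 0))).1 i'
        rwa [hτc] at this
    simpa using this
  have h1 := hmin _ (hl _ (hτ 0))
  have h2 : (Fintype.card ι : ℝ) * spread (V (τ 0) i) ≤
      Fintype.card ι * (Fintype.card K * (Fintype.card K * (2 * (ε / (4 * C))))) := by gcongr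
  have h3 : Fintype.card ι * (Fintype.card K * (Fintype.card K * (2 * (ε / (4 * C))))) = ε / 2 := by
    have : Fintype.card ι * (Fintype.card K * (Fintype.card K * (2 * (ε / (4 * C))))) =
        C * (2 * (ε / (4 * C))) := by rw [hC]; ring
    rw [this]
    field_simp
    norm_num
  linarith

end Labels

section Equipartition

variable {K : Type*} [Field K]

/-- Vertex labels of a subdivided face, sent back to letters. -/
noncomputable def labelChain {B : Type*} (K : Type*) [Field K] [DecidableEq B] [Fintype B]
    (lbl : List B → (B → ℝ) → B) (R : ℕ) : ListChain K B →ₗ[K] ListChain K B :=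
  Finsupp.linearCombination K fun w =>
    map (lbl w) (iterSd R (map (fun b => (Pi.single b 1 : B → ℝ)) (Finsupp.single w 1)))

theorem labelChain_single {B : Type*} [DecidableEq B] [Fintype B]
    (lbl : List B → (B → ℝ) → B) (R : ℕ) (w : List B) :
    labelChain K lbl R (Finsupp.single w 1) =
      map (lbl w) (iterSd R (Finsupp.single (w.map fun b => (Pi.single b 1 : B → ℝ)) 1)) := by
  rw [labelChain, Finsupp.linearCombination_single, one_smul, map_single]

theorem bd_labelChain {B : Type*} [DecidableEq B] [Fintype B]
    {lbl : List B → (B → ℝ) → B} (R : ℕ) {w : List B}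
    (h : ∀ w' : List B, w'.Sublist w → ∀ τ ∈ face w', lbl w' τ = lbl w τ) :
    bd (labelChain K lbl R (Finsupp.single w 1)) = labelChain K lbl R (bdList K w) := by
  have key : labelChain K lbl R (bdList K w) = (map (lbl w) ∘ₗ iterSd (K := K) R ∘ₗ
      map (fun b => (Pi.single b 1 : B → ℝ))) (bdList K w) := by
    refine eq_of_supported (s := {w' | w'.Sublist w}) _ _ (fun w' hw' => ?_)
      (Finsupp.supported_mono (fun _ h => h.1) (bdList_mem w))
    rw [labelChain_single, LinearMap.comp_apply, LinearMap.comp_apply, map_single]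
    refine map_congr_of_supported (h w' hw') (t := {l | ∀ τ ∈ l, τ ∈ face w'}) (fun l hl => hl) ?_
    refine Finsupp.supported_mono (fun _ h => h.2)
      (iterSd_mem_of_convex (convex_face w') R fun τ hτ => ?_)
    obtain ⟨b, hb, rfl⟩ := List.mem_map.1 hτ
    exact single_mem_face hb
  rw [key, labelChain_single, ← map_bd, bd_iterSd, LinearMap.comp_apply, LinearMap.comp_apply,
    ← bd_single, map_bd, map_single]

variable {ι : Type*} [Fintype K] [Fintype ι]

theorem labelChain_sh [DecidableEq ι] [DecidableEq K]
    {lbl : List (ι × K) → (ι × K → ℝ) → ι × K} (R : ℕ) {w : List (ι × K)} {a : K}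
    (h : ∀ τ ∈ face w, lbl (w.map (sh a)) (τ ∘ sh (-a)) = sh a (lbl w τ)) :
    labelChain K lbl R (Finsupp.single (w.map (sh a)) 1) =
      map (sh a) (labelChain K lbl R (Finsupp.single w 1)) := by
  have hv : ((w.map (sh a)).map fun b => (Pi.single b 1 : ι × K → ℝ)) =
      (w.map fun b => (Pi.single b 1 : ι × K → ℝ)).map
        (LinearMap.funLeft ℝ ℝ (sh (-a) : ι × K → ι × K)) := by
    rw [List.map_map, List.map_map]
    refine List.map_congr_left fun b _ => ?_
    funext b'
    have : b' = sh a b ↔ sh (-a) b' = b := by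
      constructor
      · rintro rfl
        rw [← Function.comp_apply (f := sh (-a)), ← sh_add, neg_add_cancel, sh_zero, id]
      · rintro rfl
        rw [← Function.comp_apply (f := sh a), ← sh_add, add_neg_cancel, sh_zero, id]
    simp [Pi.single_apply, LinearMap.funLeft_apply, this]
  rw [labelChain_single, labelChain_single, hv, ← map_single, ← map_iterSd, map_map, map_map]
  refine map_congr_of_supported (s := face w) (fun τ hτ => h τ hτ)
    (t := {l | ∀ τ ∈ l, τ ∈ face w}) (fun l hl => hl) ?_
  refine Finsupp.supported_mono (fun _ h => h.2)
    (iterSd_mem_of_convex (convex_face w) R fun τ hτ => ?_)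
  obtain ⟨b, hb, rfl⟩ := List.mem_map.1 hτ
  exact single_mem_face hb

theorem labelChain_good [DecidableEq ι] [DecidableEq K]
    {lbl : List (ι × K) → (ι × K → ℝ) → ι × K} {R N : ℕ} {w : List (ι × K)} (hN : w.length ≤ N)
    {δ : ℝ} (hR : (1 - (N : ℝ)⁻¹) ^ R < δ)
    (h : ∀ l : List (ι × K → ℝ), (∀ τ ∈ l, τ ∈ face w) → (∀ τ ∈ l, ∀ τ' ∈ l, dist τ τ' < δ) →
        Good (l.map (lbl w))) :
    labelChain K lbl R (Finsupp.single w 1) ∈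
      Finsupp.supported K K {l | Good l ∧ l.length = w.length} := by
  rw [labelChain_single]
  have h1 := iterSd_mem_of_convex (K := K) (convex_face w) R
    (l := w.map fun b => (Pi.single b 1 : ι × K → ℝ)) fun τ hτ => by
      obtain ⟨b, hb, rfl⟩ := List.mem_map.1 hτ
      exact single_mem_face hb
  have h2 := iterSd_mem_of_dist_le (K := K) (N := N) R
    (l := w.map fun b => (Pi.single b 1 : ι × K → ℝ)) (by simpa using hN) zero_le_one
    fun x hx y hy => by
      obtain ⟨b, hb, rfl⟩ := List.mem_map.1 hx
      obtain ⟨b', hb', rfl⟩ := List.mem_map.1 hy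
      refine (dist_pi_le_iff zero_le_one).2 fun c => ?_
      rw [Pi.single_apply, Pi.single_apply, Real.dist_eq]
      split_ifs <;> simp
  refine map_mem_of_supported (map (lbl w)) (fun l hl => ?_) ((Finsupp.mem_supported _ _).2
    (Set.subset_inter ((Finsupp.mem_supported _ _).1 h1) ((Finsupp.mem_supported _ _).1 h2)))
  rw [map_single]
  refine Finsupp.single_mem_supported K _ ?_
  refine ⟨h l hl.1.2 fun τ hτ τ' hτ' => (hl.2.2 τ hτ τ' hτ').trans_lt ?_, ?_⟩
  · rwa [mul_one]
  · simpa using hl.1.1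

/-- Equivariant families of functions on the faces of a simplex can be equalized. -/
theorem exists_equipartition {p : ℕ} [Fact p.Prime] [CharP K p] [Algebra (ZMod p) K] [Nonempty ι]
    {val : List (ι × K) → (ι × K → ℝ) → ι → K → ℝ} (hcont : ∀ w, Continuous (val w))
    (hsupp : ∀ w τ, val (suppWord w τ) τ = val w τ)
    (hsh : ∀ a w τ i ℓ, val (w.map (sh a)) τ i (a + ℓ) = val w (τ ∘ sh a) i ℓ) :
    ∃ w : List (ι × K), w.Nodup ∧ ∃ τ ∈ face w, ∀ i ℓ ℓ', val w τ i ℓ = val w τ i ℓ' := by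
  classical
  by_contra! hne
  obtain ⟨lab, hlab₁, hlab₂, hlab₃⟩ := exists_label (K := K) (ι := ι)
  set lbl : List (ι × K) → (ι × K → ℝ) → ι × K :=
    fun w τ => lab (headColor (suppWord w τ)) (val w τ) with hlbl
  have hscale : ∀ w : {w : List (ι × K) // w.Nodup}, ∃ δ > 0, ∀ l : List (ι × K → ℝ),
      (∀ τ ∈ l, τ ∈ face w.1) → (∀ τ ∈ l, ∀ τ' ∈ l, dist τ τ' < δ) →
        Good (l.map (lbl w.1)) := fun w => by
    obtain ⟨δ, hδ, h⟩ := exists_good_scale (hcont w.1) (fun τ hτ h => by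
      obtain ⟨i, ℓ, ℓ', hn⟩ := hne w.1 w.2 τ hτ
      exact hn (h i ℓ ℓ'))
    exact ⟨δ, hδ, h (lbl w.1) fun τ _ => ⟨hlab₁ _ _, hlab₂ _ _⟩⟩
  choose δ hδ hgood using hscale
  have : Nonempty {w : List (ι × K) // w.Nodup} := ⟨⟨[], List.nodup_nil⟩⟩
  obtain ⟨w₀, hw₀⟩ := Finite.exists_min δ
  set N := Fintype.card (ι × K)
  have hN : 0 < N := Fintype.card_pos
  obtain ⟨R, hR⟩ : ∃ R : ℕ, (1 - (N : ℝ)⁻¹) ^ R < δ w₀ :=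
    exists_pow_lt_of_lt_one (hδ w₀) (by simpa using hN)
  refine no_equivariant_good_map (p := p) (labelChain K lbl R) ?_ (fun w hw => ?_)
    (fun a w _ => ?_) fun w hw => ?_
  · rw [labelChain_single, List.map_nil, iterSd_single_nil, map_single, List.map_nil]
  · refine bd_labelChain R fun w' hw' τ hτ => ?_
    simp only [hlbl]
    rw [← hsupp w', ← hsupp w, suppWord_eq_of_sublist hw hw' hτ]
  · refine labelChain_sh R fun τ hτ => ?_
    have hτa : (τ ∘ sh (-a)) ∘ sh a = τ := by
      rw [Function.comp_assoc, ← sh_add, neg_add_cancel, sh_zero, Function.comp_id]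
    simp only [hlbl]
    rw [suppWord_map, hτa, headColor_map_sh (suppWord_ne_nil hτ)]
    refine hlab₃ _ _ _ _ fun i ℓ => ?_
    rw [hsh, hτa]
  · exact labelChain_good hw.length_le_card (hR.trans_le (hw₀ ⟨w, hw⟩)) (hgood ⟨w, hw⟩)

end Equipartition

section Coloring

/-- The proportion of the unit interval `[q, q + 1]` lying to the left of `x`. -/
noncomputable def clamp (q : ℕ) (x : ℝ) : ℝ := max 0 (min 1 (x - q))

theorem clamp_mono (q : ℕ) : Monotone (clamp q) := fun _ _ h => by
  unfold clamp
  gcongr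

theorem continuous_clamp (q : ℕ) : Continuous (clamp q) := by
  unfold clamp
  fun_prop

theorem clamp_zero (q : ℕ) : clamp q 0 = 0 := by
  rw [clamp, zero_sub]
  exact max_eq_left ((min_le_right _ _).trans (by simp))

theorem clamp_of_lt {q m : ℕ} (h : q < m) : clamp q m = 1 := by
  have : (q : ℝ) + 1 ≤ m := by exact_mod_cast h
  rw [clamp, min_eq_left (by linarith), max_eq_right zero_le_one]

theorem exists_int_eq_clamp {q : ℕ} {x : ℝ} (h : q ≠ ⌊x⌋₊) : ∃ z : ℤ, clamp q x = z := by
  rcases le_or_gt x q with h1 | h1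
  · refine ⟨0, ?_⟩
    rw [clamp, Int.cast_zero]
    exact max_eq_left ((min_le_right _ _).trans (by linarith))
  rcases le_or_gt (q + 1 : ℝ) x with h2 | h2
  · refine ⟨1, ?_⟩
    rw [clamp, min_eq_left (by linarith), max_eq_right zero_le_one, Int.cast_one]
  · refine (h ?_).elim
    exact ((Nat.floor_eq_iff ((Nat.cast_nonneg q).trans h1.le)).2 ⟨h1.le, h2⟩).symm

variable {ι K : Type*} [DecidableEq K]

/-- Cut the line, from `x` on, into consecutive segments of lengths `M * τ b`, for `b` in the word,
and color each segment by the second component of its letter: this is the amount of color `ℓ` in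
`[q, q + 1]`. -/
noncomputable def col (M : ℝ) : List (ι × K) → (ι × K → ℝ) → ℝ → ℕ → K → ℝ
  | [], _, _, _, _ => 0
  | b :: w, τ, x, q, ℓ =>
    (if b.2 = ℓ then clamp q (x + M * τ b) - clamp q x else 0) + col M w τ (x + M * τ b) q ℓ

theorem col_nonneg {M : ℝ} (hM : 0 ≤ M) {τ : ι × K → ℝ} (hτ : ∀ b, 0 ≤ τ b) (w : List (ι × K))
    (x : ℝ) (q : ℕ) (ℓ : K) : 0 ≤ col M w τ x q ℓ := by
  induction w generalizing x with
  | nil => exact le_rfl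
  | cons b w ih =>
    refine add_nonneg ?_ (ih _)
    split_ifs
    · exact sub_nonneg.2 (clamp_mono q (le_add_of_nonneg_right (mul_nonneg hM (hτ b))))
    · exact le_rfl

theorem sum_col [Fintype K] (M : ℝ) (w : List (ι × K)) (τ : ι × K → ℝ) (x : ℝ) (q : ℕ) :
    ∑ ℓ, col M w τ x q ℓ = clamp q (x + M * (w.map τ).sum) - clamp q x := by
  induction w generalizing x with
  | nil => simp [col]
  | cons b w ih =>
    simp only [col, Finset.sum_add_distrib, ih, Finset.sum_ite_eq, Finset.mem_univ, if_true,
      List.map_cons, List.sum_cons]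
    rw [mul_add, ← add_assoc]
    ring

theorem col_suppWord (M : ℝ) (w : List (ι × K)) (τ : ι × K → ℝ) (x : ℝ) (q : ℕ) (ℓ : K) :
    col M (suppWord w τ) τ x q ℓ = col M w τ x q ℓ := by
  induction w generalizing x with
  | nil => rfl
  | cons b w ih =>
    simp only [suppWord, ne_eq, decide_not] at ih
    by_cases h : τ b = 0 <;> simp [suppWord, h, col, ih]

theorem col_map_sh [Field K] (M : ℝ) (a : K) (w : List (ι × K)) (τ : ι × K → ℝ) (x : ℝ) (q : ℕ)
    (ℓ : K) : col M (w.map (sh a)) τ x q (a + ℓ) = col M w (τ ∘ sh a) x q ℓ := by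
  induction w generalizing x with
  | nil => rfl
  | cons b w ih =>
    have : (sh a b).2 = a + ℓ ↔ b.2 = ℓ := add_right_inj a
    simp [col, ih, this]

theorem continuous_col (M : ℝ) (w : List (ι × K)) (q : ℕ) (ℓ : K) {x : (ι × K → ℝ) → ℝ}
    (hx : Continuous x) : Continuous fun τ => col M w τ (x τ) q ℓ := by
  induction w generalizing x with
  | nil => exact continuous_const
  | cons b w ih =>
    have hx' : Continuous fun τ : ι × K → ℝ => x τ + M * τ b := by fun_prop
    refine Continuous.add ?_ (ih hx')
    split_ifs
    · exact ((continuous_clamp q).comp hx').sub ((continuous_clamp q).comp hx)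
    · exact continuous_const

theorem exists_int_eq_col (M : ℝ) (w : List (ι × K)) (τ : ι × K → ℝ) (x : ℝ) (ℓ : K) :
    ∃ S : Finset ℕ, S.card ≤ 2 * (w.filter fun b => b.2 = ℓ).length ∧
      ∀ q ∉ S, ∃ z : ℤ, col M w τ x q ℓ = z := by
  induction w generalizing x with
  | nil => exact ⟨∅, by simp, fun q _ => ⟨0, by simp [col]⟩⟩
  | cons b w ih =>
    obtain ⟨S, hS, hcol⟩ := ih (x + M * τ b)
    by_cases h : b.2 = ℓ
    · refine ⟨insert ⌊x⌋₊ (insert ⌊x + M * τ b⌋₊ S), ?_, fun q hq => ?_⟩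
      · have h1 := Finset.card_insert_le ⌊x⌋₊ (insert ⌊x + M * τ b⌋₊ S)
        have h2 := Finset.card_insert_le ⌊x + M * τ b⌋₊ S
        simp only [h, List.filter_cons, decide_true, if_true, List.length_cons]
        lia
      · simp only [Finset.mem_insert, not_or] at hq
        obtain ⟨z₁, h₁⟩ := exists_int_eq_clamp hq.1
        obtain ⟨z₂, h₂⟩ := exists_int_eq_clamp hq.2.1
        obtain ⟨z₃, h₃⟩ := hcol q hq.2.2
        exact ⟨z₂ - z₁ + z₃, by simp [col, h, h₁, h₂, h₃]⟩
    · refine ⟨S, by simpa [h] using hS, fun q hq => ?_⟩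
      obtain ⟨z, hz⟩ := hcol q hq
      exact ⟨z, by simp [col, h, hz]⟩

theorem length_filter_snd_le [Fintype ι] {w : List (ι × K)} (hw : w.Nodup) (ℓ : K) :
    (w.filter fun b => b.2 = ℓ).length ≤ Fintype.card ι := by
  have : ((w.filter fun b => b.2 = ℓ).map Prod.fst).Nodup := by
    refine (hw.filter _).map_on ?_
    intro b hb b' hb' h
    simp only [List.mem_filter, decide_eq_true_eq] at hb hb'
    exact Prod.ext h (hb.2.trans hb'.2.symm)
  simpa using this.length_le_card

theorem sum_map_of_mem_face {B : Type*} [Fintype B] {w : List B} (hw : w.Nodup) {τ : B → ℝ}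
    (hτ : τ ∈ face w) : (w.map τ).sum = 1 := by
  classical
  rw [← List.sum_toFinset τ hw, ← hτ.1.2]
  exact Finset.sum_subset (Finset.subset_univ _) fun b _ hb => hτ.2 b (by simpa using hb)

end Coloring

theorem continuous_mlext {α : Type*} [Fintype α] [DecidableEq α] (v : Finset α → ℝ) :
    Continuous (mlext v) := by
  unfold mlext
  fun_prop

/-- Balanced colorings by the elements of a finite field. -/
theorem exists_balanced_coloring {p : ℕ} [Fact p.Prime] {K ι α : Type*} [Field K] [Fintype K]
    [CharP K p] [Algebra (ZMod p) K] [Fintype ι] [Nonempty ι] [Fintype α] [DecidableEq α]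
    (v : ι → Finset α → ℝ) :
    ∃ χ : α → K → ℝ, (∀ j ℓ, 0 ≤ χ j ℓ) ∧ (∀ j, ∑ ℓ, χ j ℓ = 1) ∧
      (∀ i ℓ ℓ', mlext (v i) (fun j => χ j ℓ) = mlext (v i) (fun j => χ j ℓ')) ∧
      ∀ ℓ, {j : α | χ j ℓ ≠ 0 ∧ χ j ℓ ≠ 1}.ncard ≤ 2 * Fintype.card ι := by
  classical
  let M : ℝ := ((Fintype.card α : ℕ) : ℝ)
  let pos : α → ℕ := fun j => Fintype.equivFin α j
  have hpos : Function.Injective pos :=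
    Fin.val_injective.comp (Fintype.equivFin α).injective
  obtain ⟨w, hw, τ, hτ, hval⟩ := exists_equipartition (p := p) (K := K) (ι := ι)
    (val := fun w τ i ℓ => mlext (v i) fun j => col M w τ 0 (pos j) ℓ)
    (fun w => continuous_pi fun i => continuous_pi fun ℓ => (continuous_mlext (v i)).comp
      (continuous_pi fun j => continuous_col M w (pos j) ℓ continuous_const))
    (fun w τ => by simp only [col_suppWord]) fun a w τ i ℓ => by simp only [col_map_sh]
  have hnonneg : ∀ j ℓ, 0 ≤ col M w τ 0 (pos j) ℓ := fun j ℓ =>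
    col_nonneg (Nat.cast_nonneg _) hτ.1.1 w 0 (pos j) ℓ
  have hsum : ∀ j, ∑ ℓ, col M w τ 0 (pos j) ℓ = 1 := fun j => by
    rw [sum_col, sum_map_of_mem_face hw hτ, mul_one, zero_add, clamp_zero,
      clamp_of_lt (Fintype.equivFin α j).2, sub_zero]
  refine ⟨fun j ℓ => col M w τ 0 (pos j) ℓ, hnonneg, hsum, hval, fun ℓ => ?_⟩
  obtain ⟨S, hS, hcol⟩ := exists_int_eq_col M w τ 0 ℓ
  have hsub : Set.MapsTo pos {j | col M w τ 0 (pos j) ℓ ≠ 0 ∧ col M w τ 0 (pos j) ℓ ≠ 1}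
      (S : Set ℕ) := fun j hj => by
    by_contra hjS
    obtain ⟨z, hz⟩ := hcol _ hjS
    have h0 : (0 : ℝ) ≤ z := hz ▸ hnonneg j ℓ
    have h1 : (z : ℝ) ≤ 1 := by
      rw [← hz, ← hsum j]
      exact Finset.single_le_sum (fun ℓ _ => hnonneg j ℓ) (Finset.mem_univ ℓ)
    obtain ⟨hj0, hj1⟩ := hj
    rw [hz] at hj0 hj1
    norm_cast at h0 h1 hj0 hj1
    lia
  calc _ ≤ (S : Set ℕ).ncard := Set.ncard_le_ncard_of_injOn pos hsub hpos.injOn S.finite_toSet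
    _ = S.card := Set.ncard_coe_finset S
    _ ≤ _ := hS.trans (Nat.mul_le_mul_left 2 (length_filter_snd_le hw ℓ))

end ListChain

/-- **Balanced fractional coloring with few fractional items.**
For every prime power `k = p ^ ν`, a finite set of items, and arbitrary valuation
functions `v 1, …, v n`, there is a fractional `k`-coloring `χ : α → Δ_k` such that
all colors have equal value under every multilinear extension `F_i`, and each
color-vector `χ_ℓ` has at most `2 * n` non-integral coordinates. -/
theorem fractional_coloring_prime_power
    (p ν k n : ℕ) (hp : p.Prime) (hν : 1 ≤ ν) (hk : k = p ^ ν)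
    (α : Type) [Fintype α] [DecidableEq α]
    (v : Fin n → Finset α → ℝ) :
    ∃ χ : α → Fin k → ℝ,
      (∀ (j : α) (ℓ : Fin k), χ j ℓ ∈ Set.Icc (0 : ℝ) 1) ∧
      (∀ j : α, ∑ ℓ : Fin k, χ j ℓ = 1) ∧
      (∀ (i : Fin n) (ℓ ℓ' : Fin k),
        mlext (v i) (fun j => χ j ℓ) = mlext (v i) (fun j => χ j ℓ')) ∧
      (∀ ℓ : Fin k, {j : α | χ j ℓ ≠ 0 ∧ χ j ℓ ≠ 1}.ncard ≤ 2 * n) := by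
  have : Fact p.Prime := ⟨hp⟩
  rcases Nat.eq_zero_or_pos n with rfl | hn
  · have hk0 : 0 < k := hk ▸ pow_pos hp.pos ν
    refine ⟨fun _ ℓ => if ℓ = ⟨0, hk0⟩ then 1 else 0, fun j ℓ => ?_, fun j => by simp,
      fun i => i.elim0, fun ℓ => ?_⟩
    · dsimp only
      split_ifs <;> simp
    · by_cases h : ℓ = ⟨0, hk0⟩ <;> simp [h]
  · have : Nonempty (Fin n) := ⟨⟨0, hn⟩⟩
    have : Fintype (GaloisField p ν) := Fintype.ofFinite _
    have hcard : Fintype.card (GaloisField p ν) = k := by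
      rw [← Nat.card_eq_fintype_card, GaloisField.card p ν (by lia), hk]
    obtain ⟨χ, h0, h1, heq, hfrac⟩ :=
      ListChain.exists_balanced_coloring (p := p) (K := GaloisField p ν) v
    let e : Fin k ≃ GaloisField p ν := (Fintype.equivFinOfCardEq hcard).symm
    refine ⟨fun j ℓ => χ j (e ℓ), fun j ℓ => ⟨h0 j _, ?_⟩, fun j => ?_,
      fun i ℓ ℓ' => heq i _ _, fun ℓ => ?_⟩
    · rw [← h1 j]
      exact Finset.single_le_sum (fun ℓ _ => h0 j ℓ) (Finset.mem_univ _)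
    · rw [Equiv.sum_comp e (χ j), h1]
    · simpa using hfrac (e ℓ)
end

section
/- Let M be a finite set, let v : 2^M → ℝ have marginals bounded by 1, and let x ∈ [0,1]^M be a vector with at most t ≥ 1 non-integral coordinates. Let S be a random subset of M in which each item j is included independently with probability x_j. Then for every a > 0, Pr[ |v(S) − F(x)| ≥ a ] ≤ 2·exp(−2a²/t), where F is the multilinear extension of v. -/
open MeasureTheory ProbabilityTheory in
/-- Hoeffding's lemma for a Bernoulli variable. -/
theorem bernoulli_exp_le {p : ℝ} (hp : p ∈ Set.Icc (0 : ℝ) 1) (s : ℝ) :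
    (1 - p) * Real.exp (s * (0 - p)) + p * Real.exp (s * (1 - p)) ≤ Real.exp (s ^ 2 / 8) := by
  obtain ⟨h0, h1⟩ := hp
  have h1' : 0 ≤ 1 - p := sub_nonneg.2 h1
  set μ : Measure ℝ :=
    ENNReal.ofReal (1 - p) • Measure.dirac 0 + ENNReal.ofReal p • Measure.dirac 1 with hμ
  have hprob : IsProbabilityMeasure μ := ⟨by
    simp [hμ, ← ENNReal.ofReal_add h1' h0]⟩
  have hint (f : ℝ → ℝ) : ∫ y, f y ∂μ = (1 - p) * f 0 + p * f 1 := by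
    rw [hμ, integral_add_measure
      ((integrable_dirac (by simp)).smul_measure ENNReal.ofReal_ne_top)
      ((integrable_dirac (by simp)).smul_measure ENNReal.ofReal_ne_top)]
    simp [integral_smul_measure, ENNReal.toReal_ofReal, h0, h1']
  have hmem : ∀ᵐ y ∂μ, id y ∈ Set.Icc (0 : ℝ) 1 := by
    rw [hμ, ae_add_measure_iff]
    constructor <;> refine Measure.ae_smul_measure ?_ _ <;> simp [ae_dirac_eq]
  have h := (hasSubgaussianMGF_of_mem_Icc (μ := μ) aemeasurable_id hmem).mgf_le s
  simp only [mgf, hint, id] at h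
  norm_num at h ⊢
  refine h.trans (Real.exp_le_exp.2 (by linarith))

theorem two_point_exp_le {p : ℝ} (hp : p ∈ Set.Icc (0 : ℝ) 1) {b c : ℝ} (hbc : |c - b| ≤ 1)
    (l : ℝ) :
    (1 - p) * Real.exp (l * b) + p * Real.exp (l * c)
      ≤ Real.exp (l ^ 2 / 8) * Real.exp (l * ((1 - p) * b + p * c)) := by
  have h := mul_le_mul_of_nonneg_right (bernoulli_exp_le hp (l * (c - b)))
    (Real.exp_pos (l * ((1 - p) * b + p * c))).le
  have hb : Real.exp (l * b) =
      Real.exp (l * (c - b) * (0 - p)) * Real.exp (l * ((1 - p) * b + p * c)) := by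
    rw [← Real.exp_add]; ring_nf
  have hc : Real.exp (l * c) =
      Real.exp (l * (c - b) * (1 - p)) * Real.exp (l * ((1 - p) * b + p * c)) := by
    rw [← Real.exp_add]; ring_nf
  rw [hb, hc]
  calc _ = _ := by ring
    _ ≤ _ := h
    _ ≤ _ := by
      refine mul_le_mul_of_nonneg_right (Real.exp_le_exp.2 ?_) (Real.exp_pos _).le
      rw [mul_pow]
      refine div_le_div_of_nonneg_right ?_ (by norm_num)
      exact mul_le_of_le_one_right (sq_nonneg l) ((sq_le_one_iff_abs_le_one _).2 hbc)

/-- The expectation of `f` at a random subset of `A` containing each `j ∈ A` independently with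
probability `x j`. -/
noncomputable def bernoulliExpect {α : Type*} [DecidableEq α] (x : α → ℝ) (A : Finset α)
    (f : Finset α → ℝ) : ℝ :=
  ∑ S ∈ A.powerset, ((∏ j ∈ S, x j) * ∏ j ∈ A \ S, (1 - x j)) * f S

section bernoulliExpect

variable {α : Type*} [DecidableEq α] {x : α → ℝ}

theorem bernoulliExpect_insert {A : Finset α} {j : α} (hj : j ∉ A) (f : Finset α → ℝ) :
    bernoulliExpect x (insert j A) f =
      bernoulliExpect x A fun S => (1 - x j) * f S + x j * f (insert j S) := by
  unfold bernoulliExpect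
  rw [Finset.sum_powerset_insert hj, ← Finset.sum_add_distrib]
  refine Finset.sum_congr rfl fun S hS => ?_
  have hjS : j ∉ S := fun h => hj (Finset.mem_powerset.1 hS h)
  rw [Finset.prod_insert hjS, Finset.insert_sdiff_of_notMem _ hjS,
    Finset.prod_insert (by simp [hj]), Finset.insert_sdiff_insert,
    Finset.sdiff_insert_of_notMem hj]
  ring

theorem bernoulliExpect_mono (hx : ∀ j, x j ∈ Set.Icc (0 : ℝ) 1) (A : Finset α)
    {f g : Finset α → ℝ} (hfg : ∀ S, f S ≤ g S) :
    bernoulliExpect x A f ≤ bernoulliExpect x A g :=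
  Finset.sum_le_sum fun S _ => mul_le_mul_of_nonneg_left (hfg S) <|
    mul_nonneg (Finset.prod_nonneg fun j _ => (hx j).1)
      (Finset.prod_nonneg fun j _ => sub_nonneg.2 (hx j).2)

theorem bernoulliExpect_const_mul (A : Finset α) (c : ℝ) (f : Finset α → ℝ) :
    bernoulliExpect x A (fun S => c * f S) = c * bernoulliExpect x A f := by
  simp only [bernoulliExpect, Finset.mul_sum]
  exact Finset.sum_congr rfl fun S _ => by ring

theorem bernoulliExpect_add (A : Finset α) (f g : Finset α → ℝ) :
    bernoulliExpect x A (fun S => f S + g S) = bernoulliExpect x A f + bernoulliExpect x A g := by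
  simp only [bernoulliExpect, mul_add, Finset.sum_add_distrib]

open Classical in
/-- The moment generating function of a set function with marginals bounded by `1` is
subgaussian, with one unit of variance proxy `1 / 4` per non-integral coordinate. -/
theorem bernoulliExpect_exp_le (hx : ∀ j, x j ∈ Set.Icc (0 : ℝ) 1) (l : ℝ) (A : Finset α)
    (v : Finset α → ℝ) (hv : ∀ (S : Finset α) (j : α), |v (insert j S) - v S| ≤ 1) :
    bernoulliExpect x A (fun S => Real.exp (l * v S))
      ≤ Real.exp (l ^ 2 / 8 * (A.filter fun j => x j ≠ 0 ∧ x j ≠ 1).card)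
        * Real.exp (l * bernoulliExpect x A v) := by
  induction A using Finset.induction_on generalizing v with
  | empty => simp [bernoulliExpect]
  | insert j A hj ih =>
    rw [bernoulliExpect_insert hj, bernoulliExpect_insert hj]
    set w : Finset α → ℝ := fun S => (1 - x j) * v S + x j * v (insert j S) with hw
    have h0 := (hx j).1
    have h1 : 0 ≤ 1 - x j := sub_nonneg.2 (hx j).2
    have hwv (S : Finset α) (i : α) : |w (insert i S) - w S| ≤ 1 := by
      have e : w (insert i S) - w S = (1 - x j) * (v (insert i S) - v S)
          + x j * (v (insert i (insert j S)) - v (insert j S)) := by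
        simp only [hw]
        rw [Finset.insert_comm j i S]
        ring
      rw [e]
      refine (abs_add_le _ _).trans ?_
      rw [abs_mul, abs_mul, abs_of_nonneg h0, abs_of_nonneg h1]
      nlinarith [hv S i, hv (insert j S) i]
    have ihw := ih w hwv
    by_cases hfr : x j ≠ 0 ∧ x j ≠ 1
    · rw [Finset.filter_insert, if_pos hfr, Finset.card_insert_of_notMem (by simp [hj])]
      calc _ ≤ bernoulliExpect x A fun S => Real.exp (l ^ 2 / 8) * Real.exp (l * w S) :=
            bernoulliExpect_mono hx A fun S => two_point_exp_le (hx j) (hv S j) l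
        _ ≤ _ := by
          rw [bernoulliExpect_const_mul, Nat.cast_add, Nat.cast_one, mul_add, mul_one,
            add_comm, Real.exp_add, mul_assoc]
          gcongr
    · rw [Finset.filter_insert, if_neg hfr]
      refine (bernoulliExpect_mono hx A fun S => ?_).trans ihw
      have : x j = 0 ∨ x j = 1 := by tauto
      rcases this with h | h <;> simp [hw, h]

end bernoulliExpect

open Classical in
/-- **Concentration of randomized rounding (McDiarmid).**
Let `v` have marginals bounded by `1` and let `x ∈ [0,1]^M` have at most `t ≥ 1`
non-integral coordinates. Include each item `j` independently with probability
`x j`; the probability that the resulting random set `S` satisfies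
`|v S - F(x)| ≥ a` is at most `2 * exp (-2 a² / t)`. The probability of the event
is written as the sum of the product-Bernoulli weights of the sets realizing it. -/
theorem rounding_concentration
    {α : Type*} [Fintype α] [DecidableEq α]
    (v : Finset α → ℝ)
    (hv : ∀ (S : Finset α) (j : α), |v (insert j S) - v S| ≤ 1)
    (x : α → ℝ) (hx : ∀ j, x j ∈ Set.Icc (0 : ℝ) 1)
    (t : ℕ) (ht : 1 ≤ t)
    (hfrac : {j : α | x j ≠ 0 ∧ x j ≠ 1}.ncard ≤ t)
    (a : ℝ) (ha : 0 < a) :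
    ∑ S : Finset α,
        (if a ≤ |v S - mlext v x| then (∏ j ∈ S, x j) * ∏ j ∈ Sᶜ, (1 - x j) else 0)
      ≤ 2 * Real.exp (-(2 * a ^ 2) / t) := by
  have htpos : (0 : ℝ) < t := by exact_mod_cast ht
  have hmean : mlext v x = bernoulliExpect x Finset.univ v := by
    simp [mlext, bernoulliExpect, Finset.compl_eq_univ_sdiff, mul_comm]
  have hcard : ((Finset.univ.filter fun j => x j ≠ 0 ∧ x j ≠ 1).card : ℝ) ≤ t := by
    rw [Set.ncard_eq_toFinset_card'] at hfrac
    simpa using hfrac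
  have hexp (l : ℝ) (hl : l ^ 2 = (4 * a / t) ^ 2) :
      bernoulliExpect x Finset.univ
        (fun S => Real.exp (-(4 * a / t) * a - l * mlext v x) * Real.exp (l * v S))
        ≤ Real.exp (-(2 * a ^ 2) / t) := by
    rw [bernoulliExpect_const_mul]
    refine (mul_le_mul_of_nonneg_left (bernoulliExpect_exp_le hx l Finset.univ v hv)
      (Real.exp_pos _).le).trans ?_
    rw [← hmean, ← Real.exp_add, ← Real.exp_add, Real.exp_le_exp]
    have h1 := mul_le_mul_of_nonneg_left hcard (by positivity : 0 ≤ l ^ 2 / 8)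
    have h2 : l ^ 2 / 8 * t - (4 * a / t) * a = -(2 * a ^ 2) / t := by
      rw [hl]
      field_simp
      ring
    linarith
  calc _ = bernoulliExpect x Finset.univ
          (fun S => if a ≤ |v S - mlext v x| then (1 : ℝ) else 0) := by
        simp [bernoulliExpect, Finset.compl_eq_univ_sdiff]
    _ ≤ bernoulliExpect x Finset.univ (fun S =>
          Real.exp (-(4 * a / t) * a - (4 * a / t) * mlext v x) * Real.exp ((4 * a / t) * v S)
          + Real.exp (-(4 * a / t) * a - -(4 * a / t) * mlext v x)
            * Real.exp (-(4 * a / t) * v S)) := by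
        refine bernoulliExpect_mono hx _ fun S => ?_
        have hl : 0 ≤ 4 * a / t := by positivity
        simp only [← Real.exp_add]
        split_ifs with h
        · rcases le_abs.1 h with h | h
          · refine le_add_of_le_of_nonneg (Real.one_le_exp ?_) (Real.exp_pos _).le
            nlinarith [mul_le_mul_of_nonneg_left h hl]
          · refine le_add_of_nonneg_of_le (Real.exp_pos _).le (Real.one_le_exp ?_)
            nlinarith [mul_le_mul_of_nonneg_left h hl]
        · positivity
    _ ≤ _ := by
        rw [bernoulliExpect_add, two_mul]
        exact add_le_add (hexp _ rfl) (hexp _ (neg_sq _))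
end
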